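/- arXiv:2412.11843 — 4 statements merged into one kernel-verified Lean document; each statement's English description precedes it below -/
import Mathlib

section
/- Let G be a finite connected simple graph containing exactly one cycle (a connected unicyclic graph). Then the edge ideal I(G) is bridge-friendly if and only if one of the following holds: (i) the unique cycle of G has length 3 and contains a vertex whose degree in G is 2; (ii) the unique cycle of G has length 5 and contains a vertex whose degree in G is 2; (iii) the unique cycle of G has length 6 and contains two vertices at distance 3 from each other along the cycle (opposite vertices) each of whose degree in G is 2. -/
/-- The "lcm" of a collection of supports of squarefree monomials: the union. -/
def lcmU {α : Type*} [DecidableEq α] (σ : Finset (Finset α)) : Finset α := σ.sup id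

/-- `m` is a bridge of `σ`: `m ∈ σ` and removing `m` does not change the lcm. -/
def IsBridge {α : Type*} [DecidableEq α] (σ : Finset (Finset α)) (m : Finset α) : Prop :=
  m ∈ σ ∧ lcmU (σ.erase m) = lcmU σ

/-- `m` is a gap of `σ` (relative to the generating set `M`): `m ∈ M`, `m ∉ σ`,
and adding `m` does not change the lcm. -/
def IsGap {α : Type*} [DecidableEq α] (M : Set (Finset α)) (σ : Finset (Finset α))
    (m : Finset α) : Prop :=
  m ∈ M ∧ m ∉ σ ∧ lcmU (insert m σ) = lcmU σ

/-- `m` is a true gap of `σ` w.r.t. the total order encoded by `ord`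
(`a` dominates `b` iff `ord b < ord a`). -/
def IsTrueGap {α : Type*} [DecidableEq α] (M : Set (Finset α)) (ord : Finset α → ℕ)
    (σ : Finset (Finset α)) (m : Finset α) : Prop :=
  IsGap M σ m ∧ ∀ m', IsBridge (insert m σ) m' → ord m' < ord m → IsBridge σ m'

/-- `σ` is potentially-type-2: it has a bridge dominating no true gap of `σ`. -/
def PotType2 {α : Type*} [DecidableEq α] (M : Set (Finset α)) (ord : Finset α → ℕ)
    (σ : Finset (Finset α)) : Prop :=
  ∃ m, IsBridge σ m ∧ ∀ g, IsTrueGap M ord σ g → ¬ ord g < ord m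

/-- `b` is the smallest bridge of `σ` w.r.t. the total order encoded by `ord`. -/
def IsSBridge {α : Type*} [DecidableEq α] (ord : Finset α → ℕ) (σ : Finset (Finset α))
    (b : Finset α) : Prop :=
  IsBridge σ b ∧ ∀ b', IsBridge σ b' → ord b ≤ ord b'

/-- `σ` is type-2: it is potentially-type-2, and any other potentially-type-2 `σ'` with
`σ' \ {sbridge σ'} = σ \ {sbridge σ}` satisfies `sbridge σ' ≻ sbridge σ`. -/
def Type2 {α : Type*} [DecidableEq α] (M : Set (Finset α)) (ord : Finset α → ℕ)
    (σ : Finset (Finset α)) : Prop :=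
  PotType2 M ord σ ∧ ∀ σ' : Finset (Finset α), ↑σ' ⊆ M → σ' ≠ σ → PotType2 M ord σ' →
    ∀ b b', IsSBridge ord σ b → IsSBridge ord σ' b' → σ'.erase b' = σ.erase b →
      ord b < ord b'

/-- `M` (an antichain of supports of the minimal generators of a squarefree monomial
ideal) is bridge-friendly: there is a total order on `M` (encoded by an injection
`ord : Finset α → ℕ`, where `a ≻ b` iff `ord b < ord a`) for which every
potentially-type-2 subset of `M` is type-2. -/
def BridgeFriendly {α : Type*} [DecidableEq α] (M : Set (Finset α)) : Prop :=
  ∃ ord : Finset α → ℕ, Set.InjOn ord M ∧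
    ∀ σ : Finset (Finset α), ↑σ ⊆ M → PotType2 M ord σ → Type2 M ord σ

/-- The set of edges of a simple graph `G`, each edge recorded as a 2-element
`Finset` of vertices; this is the set of supports of the minimal generators of the
edge ideal `I(G)`. -/
def edgeSets {V : Type*} [DecidableEq V] (G : SimpleGraph V) : Set (Finset V) :=
  {s | ∃ u v, G.Adj u v ∧ s = {u, v}}

/-- `G` contains exactly one cycle: some closed walk of `G` is a cycle, and all
cycles of `G` have the same edge set. -/
def ExactlyOneCycle {V : Type*} [DecidableEq V] (G : SimpleGraph V) : Prop :=
  (∃ (u : V) (w : G.Walk u u), w.IsCycle) ∧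
    ∀ (u v : V) (w : G.Walk u u) (w' : G.Walk v v), w.IsCycle → w'.IsCycle →
      w.edges.toFinset = w'.edges.toFinset

section Bridges

variable {α : Type*} [DecidableEq α]

lemma mem_lcmU {σ : Finset (Finset α)} {z : α} : z ∈ lcmU σ ↔ ∃ e ∈ σ, z ∈ e := by
  simp [lcmU, Finset.mem_sup]

lemma isBridge_iff_forall_exists_ne {σ : Finset (Finset α)} {m : Finset α} :
    IsBridge σ m ↔ m ∈ σ ∧ ∀ z ∈ m, ∃ e ∈ σ, e ≠ m ∧ z ∈ e := by
  refine and_congr_right fun hm => ?_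
  rw [Finset.ext_iff]
  simp only [mem_lcmU, Finset.mem_erase]
  constructor
  · intro h z hz
    obtain ⟨e, ⟨h1, h2⟩, h3⟩ := (h z).2 ⟨m, hm, hz⟩
    exact ⟨e, h2, h1, h3⟩
  · intro h z
    constructor
    · rintro ⟨e, ⟨_, h2⟩, h3⟩
      exact ⟨e, h2, h3⟩
    · rintro ⟨e, h2, h3⟩
      by_cases hem : e = m
      · subst hem
        obtain ⟨e', h4, h5, h6⟩ := h z h3
        exact ⟨e', ⟨h5, h4⟩, h6⟩
      · exact ⟨e, ⟨hem, h2⟩, h3⟩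

lemma isGap_iff_forall_exists {M : Set (Finset α)} {σ : Finset (Finset α)} {g : Finset α} :
    IsGap M σ g ↔ g ∈ M ∧ g ∉ σ ∧ ∀ z ∈ g, ∃ e ∈ σ, z ∈ e := by
  refine and_congr_right fun _ => and_congr_right fun _ => ?_
  rw [Finset.ext_iff]
  simp only [mem_lcmU, Finset.mem_insert]
  constructor
  · intro h z hz
    exact (h z).1 ⟨g, Or.inl rfl, hz⟩
  · intro h z
    constructor
    · rintro ⟨e, rfl | h2, h3⟩
      · exact h z h3
      · exact ⟨e, h2, h3⟩
    · rintro ⟨e, h2, h3⟩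
      exact ⟨e, Or.inr h2, h3⟩

/-- `insert b τ` is potentially-type-2 with smallest bridge `b ∉ τ`, spelled out in terms of
covering vertices. -/
structure PotType2Via (M : Set (Finset α)) (ord : Finset α → ℕ) (τ : Finset (Finset α))
    (b : Finset α) : Prop where
  mem : b ∈ M
  notMem : b ∉ τ
  cover : ∀ z ∈ b, ∃ e ∈ τ, z ∈ e
  le_bridge : ∀ e, IsBridge (insert b τ) e → ord b ≤ ord e
  gap : ∀ g ∈ M, g ∉ τ → (∀ z ∈ g, ∃ e ∈ τ, z ∈ e) → ord g < ord b →
    ∃ n ∈ τ, ord n < ord g ∧ IsBridge (insert g (insert b τ)) n ∧ ¬ IsBridge (insert b τ) n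

lemma PotType2.via {M : Set (Finset α)} {ord : Finset α → ℕ} {σ : Finset (Finset α)}
    {b : Finset α} (hσM : ↑σ ⊆ M) (hσ : PotType2 M ord σ) (hb : IsSBridge ord σ b) :
    PotType2Via M ord (σ.erase b) b := by
  have hins : insert b (σ.erase b) = σ := Finset.insert_erase hb.1.1
  refine ⟨hσM hb.1.1, by simp, ?_, by rw [hins]; exact hb.2, ?_⟩
  · intro z hz
    obtain ⟨e, h1, h2, h3⟩ := (isBridge_iff_forall_exists_ne.1 hb.1).2 z hz
    exact ⟨e, by simp [h1, h2], h3⟩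
  · intro g hgM hg hcov hlt
    rw [hins]
    have hgσ : g ∉ σ := by
      intro h
      refine hg (Finset.mem_erase.2 ⟨?_, h⟩)
      rintro rfl
      exact lt_irrefl _ hlt
    obtain ⟨m, hm, hmg⟩ := hσ
    have hnot : ¬ IsTrueGap M ord σ g := fun h => hmg g h (hlt.trans_le (hb.2 m hm))
    have hgap : IsGap M σ g := isGap_iff_forall_exists.2 ⟨hgM, hgσ, fun z hz => by
      obtain ⟨e, he, hze⟩ := hcov z hz
      exact ⟨e, (Finset.mem_erase.1 he).2, hze⟩⟩
    simp only [IsTrueGap, not_and, not_forall] at hnot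
    obtain ⟨n, h1, h2, h3⟩ := hnot hgap
    refine ⟨n, Finset.mem_erase.2 ⟨?_, ?_⟩, h2, h1, h3⟩
    · rintro rfl
      exact lt_asymm h2 hlt
    · rcases Finset.mem_insert.1 h1.1 with rfl | h
      · exact absurd h2 (lt_irrefl _)
      · exact h

lemma exists_potType2Via_pair {M : Set (Finset α)} {ord : Finset α → ℕ}
    (hinj : Set.InjOn ord M) (hM : ¬ BridgeFriendly M) :
    ∃ (τ : Finset (Finset α)) (b b' : Finset α), ↑τ ⊆ M ∧ ord b' < ord b ∧
      PotType2Via M ord τ b ∧ PotType2Via M ord τ b' := by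
  simp only [BridgeFriendly, not_exists, not_and] at hM
  have h := hM ord hinj
  simp only [Type2, not_forall, not_and] at h
  obtain ⟨σ, hσM, hσ, h⟩ := h
  obtain ⟨σ', hσ'M, hne, hσ', b, b', hb, hb', heq, hlt⟩ := h hσ
  refine ⟨σ.erase b, b, b', (Finset.coe_subset.2 (Finset.erase_subset _ _)).trans hσM, ?_,
    hσ.via hσM hb, heq ▸ hσ'.via hσ'M hb'⟩
  refine lt_of_le_of_ne (not_lt.1 hlt) fun hord => hne ?_
  have hbb : b' = b := hinj (hσ'M hb'.1.1) (hσM hb.1.1) hord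
  subst hbb
  rw [← Finset.insert_erase hb.1.1, ← Finset.insert_erase hb'.1.1, heq]

lemma not_forall_type2_of_pair {M : Set (Finset α)} {ord : Finset α → ℕ}
    {τ : Finset (Finset α)} {m b b' : Finset α} (hτ : ↑τ ⊆ M) (hbM : b ∈ M) (hb'M : b' ∈ M)
    (hne : b ≠ b') (hbτ : b ∉ τ) (hb'τ : b' ∉ τ) (hmb : ord m < ord b) (hmb' : ord m < ord b')
    (hb : ∀ e, IsBridge (insert b τ) e ↔ e = b) (hb' : ∀ e, IsBridge (insert b' τ) e ↔ e = b')
    (hm : IsBridge (insert b' (insert b τ)) m)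
    (hgap : ∀ g ∈ M, (∀ z ∈ g, ∃ e ∈ τ, z ∈ e) → g ∈ insert b' (insert b τ)) :
    ¬ ∀ σ : Finset (Finset α), ↑σ ⊆ M → PotType2 M ord σ → Type2 M ord σ := by
  intro h
  have key : ∀ {b b' : Finset α}, b ≠ b' → ord m < ord b → ord m < ord b' →
      (∀ e, IsBridge (insert b τ) e ↔ e = b) → IsBridge (insert b' (insert b τ)) m →
      (∀ g ∈ M, (∀ z ∈ g, ∃ e ∈ τ, z ∈ e) → g ∈ insert b' (insert b τ)) → b ∉ τ →
      PotType2 M ord (insert b τ) := by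
    intro b b' hne hmb hmb' hb hm hgap hbτ
    refine ⟨b, (hb b).2 rfl, fun g hg _ => ?_⟩
    obtain ⟨hg1, hg2, hg3⟩ := isGap_iff_forall_exists.1 hg.1
    have hcov : ∀ z ∈ g, ∃ e ∈ τ, z ∈ e := by
      intro z hz
      obtain ⟨e, he, hze⟩ := hg3 z hz
      rcases Finset.mem_insert.1 he with rfl | he
      · obtain ⟨e', h1, h2, h3⟩ := (isBridge_iff_forall_exists_ne.1 ((hb e).2 rfl)).2 z hze
        exact ⟨e', (Finset.mem_insert.1 h1).resolve_left h2, h3⟩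
      · exact ⟨e, he, hze⟩
    have hgb : g = b' := (Finset.mem_insert.1 (hgap g hg1 hcov)).resolve_right hg2
    subst hgb
    have := (hb m).1 (hg.2 m hm hmb')
    subst this
    exact lt_irrefl _ hmb
  have h1 := key hne hmb hmb' hb hm hgap hbτ
  have h2 := key hne.symm hmb' hmb hb' (by rwa [Finset.insert_comm])
    (by rwa [Finset.insert_comm]) hb'τ
  have hsub : ∀ {b}, b ∈ M → (↑(insert b τ) : Set (Finset α)) ⊆ M := by
    intro b hb
    rw [Finset.coe_insert]
    exact Set.insert_subset hb hτ
  have hins : insert b τ ≠ insert b' τ := by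
    intro heq
    have : b ∈ insert b' τ := heq ▸ Finset.mem_insert_self b τ
    exact (Finset.mem_insert.1 this).elim hne hbτ
  have hs : IsSBridge ord (insert b τ) b := ⟨(hb b).2 rfl, fun e he => by rw [(hb e).1 he]⟩
  have hs' : IsSBridge ord (insert b' τ) b' := ⟨(hb' b').2 rfl, fun e he => by rw [(hb' e).1 he]⟩
  have e1 : (insert b τ).erase b = τ := Finset.erase_insert hbτ
  have e2 : (insert b' τ).erase b' = τ := Finset.erase_insert hb'τ
  exact lt_asymm
    ((h _ (hsub hbM) h1).2 _ (hsub hb'M) hins.symm h2 b b' hs hs' (e2.trans e1.symm))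
    ((h _ (hsub hb'M) h2).2 _ (hsub hbM) hins h1 b' b hs' hs (e1.trans e2.symm))

end Bridges

section EdgeSets

variable {V : Type*} [DecidableEq V] {G : SimpleGraph V}

lemma pair_mem_edgeSets {u v : V} : ({u, v} : Finset V) ∈ edgeSets G ↔ G.Adj u v := by
  constructor
  · rintro ⟨a, b, hab, h⟩
    have h1 : a ∈ ({u, v} : Finset V) := by simp [h]
    have h2 : b ∈ ({u, v} : Finset V) := by simp [h]
    have h3 : u ∈ ({a, b} : Finset V) := by simp [← h]
    have h4 : v ∈ ({a, b} : Finset V) := by simp [← h]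
    have := hab.ne
    have := hab.symm
    simp only [Finset.mem_insert, Finset.mem_singleton] at h1 h2 h3 h4
    grind
  · intro h
    exact ⟨u, v, h, rfl⟩

lemma exists_eq_pair_of_mem {s : Finset V} (hs : s ∈ edgeSets G) {z : V} (hz : z ∈ s) :
    ∃ w, G.Adj z w ∧ s = {z, w} := by
  obtain ⟨a, b, hab, rfl⟩ := hs
  simp only [Finset.mem_insert, Finset.mem_singleton] at hz
  rcases hz with rfl | rfl
  · exact ⟨b, hab, rfl⟩
  · exact ⟨a, hab.symm, Finset.pair_comm _ _⟩

/-- A path `u - x - y - v` whose edges witness a failure of bridge-friendliness over `τ`. -/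
structure BadPath (G : SimpleGraph V) (ord : Finset V → ℕ) (τ : Finset (Finset V))
    (x y u v : V) : Prop where
  sub : ↑τ ⊆ edgeSets G
  mem : {x, y} ∈ τ
  left : PotType2Via (edgeSets G) ord τ {x, u}
  right : PotType2Via (edgeSets G) ord τ {y, v}
  lt_left : ord {x, y} < ord {x, u}
  lt_right : ord {x, y} < ord {y, v}
  only_left : ∀ e ∈ τ, x ∈ e → e = {x, y}
  only_right : ∀ e ∈ τ, y ∈ e → e = {x, y}

namespace BadPath

variable {ord : Finset V → ℕ} {τ : Finset (Finset V)} {x y u v : V}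

lemma symm (h : BadPath G ord τ x y u v) : BadPath G ord τ y x v u := by
  obtain ⟨h1, h2, h3, h4, h5, h6, h7, h8⟩ := h
  rw [Finset.pair_comm x y] at h2 h5 h6 h7 h8
  exact ⟨h1, h2, h4, h3, h6, h5, h8, h7⟩

lemma adj (h : BadPath G ord τ x y u v) : G.Adj x y := pair_mem_edgeSets.1 (h.sub h.mem)

lemma adj_left (h : BadPath G ord τ x y u v) : G.Adj x u := pair_mem_edgeSets.1 h.left.mem

lemma ne_left (h : BadPath G ord τ x y u v) : u ≠ y := by
  rintro rfl
  exact h.left.notMem h.mem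

end BadPath

lemma exists_badPath {ord : Finset V → ℕ} (hinj : Set.InjOn ord (edgeSets G))
    (hG : ¬ BridgeFriendly (edgeSets G)) : ∃ τ x y u v, BadPath G ord τ x y u v := by
  obtain ⟨τ, b, b', hτ, hlt, hb, hb'⟩ := exists_potType2Via_pair hinj hG
  obtain ⟨m, hmτ, hm, hm1, hm2⟩ := hb.gap b' hb'.mem hb'.notMem hb'.cover hlt
  have hm3 : ¬ IsBridge (insert b' τ) m := fun h => (hb'.le_bridge m h).not_gt hm
  have hmb : b ≠ m := by
    rintro rfl
    exact hb.notMem hmτ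
  have hmb' : b' ≠ m := by
    rintro rfl
    exact hb'.notMem hmτ
  simp only [isBridge_iff_forall_exists_ne, Finset.mem_insert, hmτ, or_true, true_and]
    at hm1 hm2 hm3
  push Not at hm2 hm3
  obtain ⟨y, hy, hy'⟩ := hm2
  obtain ⟨x, hx, hx'⟩ := hm3
  have hxb : x ∈ b := by
    obtain ⟨e, rfl | rfl | he, h1, h2⟩ := hm1 x hx
    · exact absurd h2 (hx' _ (Or.inl rfl) h1)
    · exact h2
    · exact absurd h2 (hx' _ (Or.inr he) h1)
  have hyb : y ∈ b' := by
    obtain ⟨e, rfl | rfl | he, h1, h2⟩ := hm1 y hy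
    · exact h2
    · exact absurd h2 (hy' _ (Or.inl rfl) h1)
    · exact absurd h2 (hy' _ (Or.inr he) h1)
  have hne : y ≠ x := by
    rintro rfl
    exact hy' _ (Or.inl rfl) hmb hxb
  obtain ⟨w, -, rfl⟩ := exists_eq_pair_of_mem (hτ hmτ) hx
  have hyw : y = w := by
    simpa [hne] using hy
  subst hyw
  obtain ⟨u, -, rfl⟩ := exists_eq_pair_of_mem hb.mem hxb
  obtain ⟨v, -, rfl⟩ := exists_eq_pair_of_mem hb'.mem hyb
  refine ⟨τ, x, y, u, v, hτ, hmτ, hb, hb', hm.trans hlt, hm, ?_, ?_⟩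
  · intro e he hxe
    by_contra hne'
    exact hx' e (Or.inr he) hne' hxe
  · intro e he hye
    by_contra hne'
    exact hy' e (Or.inr he) hne' hye

lemma isBridge_insert_iff_eq {x y u v t t' : V} (hxy : x ≠ y) (hxu : x ≠ u) (hyu : y ≠ u)
    (hyv : y ≠ v) (htu : t ≠ u) (htx : t ≠ x) (hty : t ≠ y) (htx' : t' ≠ x)
    (hty' : t' ≠ y)
    (hend : ({u, t} : Finset V) = {v, t'} ∨ t ≠ v ∧ t ≠ t' ∧ t' ≠ u) (e : Finset V) :
    IsBridge (insert {x, u} {{x, y}, {u, t}, {v, t'}}) e ↔ e = {x, u} := by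
  rw [isBridge_iff_forall_exists_ne]
  simp only [Finset.mem_insert, Finset.mem_singleton]
  have hut : (∀ z ∈ ({u, t} : Finset V), ∃ e : Finset V,
      (e = {x, u} ∨ e = {x, y} ∨ e = {u, t} ∨ e = {v, t'}) ∧ e ≠ {u, t} ∧ z ∈ e) → False := by
    intro h
    obtain ⟨e, he, h1, h2⟩ := h t (by simp)
    rcases he with rfl | rfl | rfl | rfl
    · simp [htx, htu] at h2
    · simp [htx, hty] at h2
    · exact h1 rfl
    · rcases hend with h | ⟨h3, h4, -⟩
      · exact h1 h.symm
      · simp [h3, h4] at h2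
  constructor
  · rintro ⟨rfl | rfl | rfl | rfl, h⟩
    · rfl
    · obtain ⟨e, he, h1, h2⟩ := h y (by simp)
      rcases he with rfl | rfl | rfl | rfl
      · simp [hxy.symm, hyu] at h2
      · exact absurd rfl h1
      · simp [hyu, hty.symm] at h2
      · simp [hyv, hty'.symm] at h2
    · exact (hut h).elim
    · rcases hend with heq | ⟨h3, h4, h5⟩
      · rw [← heq] at h hut
        exact (hut h).elim
      · obtain ⟨e, he, h1, h2⟩ := h t' (by simp)
        rcases he with rfl | rfl | rfl | rfl
        · simp [htx', h5] at h2
        · simp [htx', hty'] at h2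
        · simp [h4.symm, h5] at h2
        · exact absurd rfl h1
  · rintro rfl
    refine ⟨Or.inl rfl, fun z hz => ?_⟩
    simp only [Finset.mem_insert, Finset.mem_singleton] at hz
    rcases hz with rfl | rfl
    · refine ⟨{z, y}, by simp, fun h => ?_, by simp⟩
      have : y ∈ ({z, u} : Finset V) := by simp [← h]
      simp [hxy.symm, hyu] at this
    · refine ⟨{z, t}, by simp, fun h => ?_, by simp⟩
      have : t ∈ ({x, z} : Finset V) := by simp [← h]
      simp [htx, htu] at this

/-- A walk `t - u - x - y - v - t'` (with possible coincidences of its end edges) spanning no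
further edge of `G` prevents an order in which its middle edge is smaller than its neighbours. -/
lemma not_forall_type2_of_path {ord : Finset V → ℕ} {x y u v t t' : V}
    (hxy : G.Adj x y) (hxu : G.Adj x u) (hyv : G.Adj y v) (hut : G.Adj u t) (hvt : G.Adj v t')
    (huy : u ≠ y) (hvx : v ≠ x) (htx : t ≠ x) (hty : t ≠ y) (htx' : t' ≠ x) (hty' : t' ≠ y)
    (hend : ({u, t} : Finset V) = {v, t'} ∨ Disjoint ({u, t} : Finset V) {v, t'})
    (hchord : ∀ p q, G.Adj p q → p ∈ ({x, y, u, v, t, t'} : Finset V) →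
      q ∈ ({x, y, u, v, t, t'} : Finset V) → ({p, q} : Finset V) ∈
        ({{x, y}, {x, u}, {y, v}, {u, t}, {v, t'}} : Finset (Finset V)))
    (hlt : ord {x, y} < ord {x, u}) (hlt' : ord {x, y} < ord {y, v}) :
    ¬ ∀ σ : Finset (Finset V), ↑σ ⊆ edgeSets G → PotType2 (edgeSets G) ord σ →
      Type2 (edgeSets G) ord σ := by
  have pair_ne : ∀ {a b c d : V}, a ≠ c → a ≠ d → ({a, b} : Finset V) ≠ {c, d} := by
    intro a b c d h1 h2 h
    have : a ∈ ({c, d} : Finset V) := by simp [← h]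
    simp [h1, h2] at this
  have pair_ne' : ∀ {a b c d : V}, b ≠ c → b ≠ d → ({a, b} : Finset V) ≠ {c, d} := by
    intro a b c d h1 h2
    rw [Finset.pair_comm]
    exact pair_ne h1 h2
  have hxyne := hxy.ne
  have hxune := hxu.ne
  have hyvne := hyv.ne
  have hutne := hut.ne
  have hvtne := hvt.ne
  have hend' : ({u, t} : Finset V) = {v, t'} ∨ t ≠ v ∧ t ≠ t' ∧ t' ≠ u := by
    refine hend.imp id fun h => ?_
    simp only [Finset.disjoint_left, Finset.mem_insert, Finset.mem_singleton, not_or] at h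
    exact ⟨(h (Or.inr rfl)).1, (h (Or.inr rfl)).2, fun h' => (h (Or.inl rfl)).2 h'.symm⟩
  refine not_forall_type2_of_pair (τ := {{x, y}, {u, t}, {v, t'}}) (m := {x, y}) (b := {x, u})
    (b' := {y, v}) ?_ (pair_mem_edgeSets.2 hxu) (pair_mem_edgeSets.2 hyv)
    (pair_ne hxyne hvx.symm) ?_ ?_ hlt hlt' ?_ ?_ ?_ ?_
  · intro e he
    simp only [Finset.coe_insert, Finset.coe_singleton, Set.mem_insert_iff,
      Set.mem_singleton_iff] at he
    rcases he with rfl | rfl | rfl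
    exacts [pair_mem_edgeSets.2 hxy, pair_mem_edgeSets.2 hut, pair_mem_edgeSets.2 hvt]
  · simp only [Finset.mem_insert, Finset.mem_singleton, not_or]
    exact ⟨pair_ne' hxune.symm huy, pair_ne hxune htx.symm, pair_ne hvx.symm htx'.symm⟩
  · simp only [Finset.mem_insert, Finset.mem_singleton, not_or]
    exact ⟨pair_ne' hvx hyvne.symm, pair_ne huy.symm hty.symm, pair_ne hyvne hty'.symm⟩
  · exact isBridge_insert_iff_eq hxyne hxune huy.symm hyvne hutne.symm htx hty htx'
      hty' hend'
  · have h := isBridge_insert_iff_eq (t := t') (t' := t) hxyne.symm hyvne hvx.symm hxune hvtne.symm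
      hty' htx' hty htx (hend'.imp Eq.symm fun h => ⟨h.2.2, h.2.1.symm, h.1⟩)
    rwa [Finset.pair_comm y x, Finset.pair_comm ({v, t'} : Finset V)] at h
  · rw [isBridge_iff_forall_exists_ne]
    refine ⟨by simp, fun z hz => ?_⟩
    simp only [Finset.mem_insert, Finset.mem_singleton] at hz
    rcases hz with rfl | rfl
    · exact ⟨{z, u}, by simp, pair_ne' hxune.symm huy, by simp⟩
    · exact ⟨{z, v}, by simp, pair_ne' hvx hyvne.symm, by simp⟩
  · rintro g ⟨p, q, hpq, rfl⟩ hcov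
    have hS : ∀ z ∈ ({p, q} : Finset V), z ∈ ({x, y, u, v, t, t'} : Finset V) := by
      intro z hz
      obtain ⟨e, he, hze⟩ := hcov z hz
      simp only [Finset.mem_insert, Finset.mem_singleton] at he ⊢
      rcases he with rfl | rfl | rfl <;>
        · simp only [Finset.mem_insert, Finset.mem_singleton] at hze
          tauto
    have := hchord p q hpq (hS p (by simp)) (hS q (by simp))
    simp only [Finset.mem_insert, Finset.mem_singleton] at this ⊢
    tauto

end EdgeSets

section Unicyclic

variable {V : Type*} {G : SimpleGraph V} {n : ℕ} {c : ℕ → V}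

/-- `c` runs periodically around the only cycle of `G`, which has length `n`. -/
structure IsUniqueCycle (G : SimpleGraph V) (n : ℕ) (c : ℕ → V) : Prop where
  three_le : 3 ≤ n
  adj : ∀ i, G.Adj (c i) (c (i + 1))
  eq_iff : ∀ i j, c i = c j ↔ i ≡ j [MOD n]
  not_isBridge : ∀ i, ¬ G.IsBridge s(c i, c (i + 1))
  exists_eq : ∀ p q, G.Adj p q → ¬ G.IsBridge s(p, q) → ∃ i, s(p, q) = s(c i, c (i + 1))
  mem_edges : ∀ i (u : V) (w : G.Walk u u), w.IsCycle → s(c i, c (i + 1)) ∈ w.edges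

lemma ExactlyOneCycle.isUniqueCycle [DecidableEq V] (hG : ExactlyOneCycle G) {u : V}
    {w : G.Walk u u} (hw : w.IsCycle) :
    IsUniqueCycle G w.length fun i => w.getVert (i % w.length) := by
  have h3 := hw.three_le_length
  have hsucc : ∀ i, w.getVert ((i + 1) % w.length) = w.getVert (i % w.length + 1) := by
    intro i
    have hlt : i % w.length < w.length := Nat.mod_lt _ (by omega)
    rw [Nat.add_mod, Nat.mod_eq_of_lt (show 1 < w.length by omega)]
    rcases Nat.lt_or_ge (i % w.length + 1) w.length with h | h
    · rw [Nat.mod_eq_of_lt h]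
    · rw [show i % w.length + 1 = w.length by omega]
      simp
  have hmem : ∀ i, s(w.getVert (i % w.length), w.getVert ((i + 1) % w.length)) ∈ w.edges := by
    intro i
    rw [SimpleGraph.Walk.mk_mem_edges_iff_exists]
    exact ⟨i % w.length, Nat.mod_lt _ (by omega), by rw [hsucc]⟩
  have hedges : ∀ {v : V} {w' : G.Walk v v}, w'.IsCycle → ∀ e, e ∈ w'.edges ↔ e ∈ w.edges := by
    intro v w' hw' e
    rw [← List.mem_toFinset, hG.2 v u w' w hw' hw, List.mem_toFinset]
  refine ⟨h3, ?_, ?_, ?_, ?_, ?_⟩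
  · intro i
    simp only [hsucc]
    exact w.adj_getVert_succ (Nat.mod_lt _ (by omega))
  · intro i j
    have hi : i % w.length < w.length := Nat.mod_lt _ (by omega)
    have hj : j % w.length < w.length := Nat.mod_lt _ (by omega)
    refine ⟨fun h => hw.getVert_injOn' ?_ ?_ h, fun h => congrArg w.getVert h⟩ <;>
      simp only [Set.mem_ofPred_eq] <;> omega
  · intro i h
    exact h.notMem_edges_of_isCycle hw (hmem i)
  · intro p q hpq h
    rw [SimpleGraph.isBridge_iff_forall_cycle_notMem (by simpa using hpq)] at h
    push Not at h
    obtain ⟨v, w', hw', h⟩ := h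
    rw [hedges hw', SimpleGraph.Walk.mk_mem_edges_iff_exists] at h
    obtain ⟨i, hi, h⟩ := h
    refine ⟨i, ?_⟩
    simp only [hsucc, Nat.mod_eq_of_lt hi, h]
  · intro i v w' hw'
    rw [hedges hw']
    exact hmem i

namespace IsUniqueCycle

lemma shift (h : IsUniqueCycle G n c) (k : ℕ) : IsUniqueCycle G n fun i => c (i + k) := by
  have hk : ∀ i, i + 1 + k = i + k + 1 := fun i => by omega
  refine ⟨h.three_le, fun i => ?_, fun i j => ?_, fun i => ?_, fun p q hpq hb => ?_,
    fun i => ?_⟩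
  · simpa only [hk] using h.adj (i + k)
  · rw [h.eq_iff]
    exact ⟨fun h => Nat.ModEq.add_right_cancel' k h, fun h => h.add_right k⟩
  · simpa only [hk] using h.not_isBridge (i + k)
  · obtain ⟨i, hi⟩ := h.exists_eq p q hpq hb
    refine ⟨i + (n - 1) * k, ?_⟩
    have hmod : i + (n - 1) * k + k ≡ i [MOD n] := by
      obtain ⟨n, rfl⟩ : ∃ m, n = m + 1 := ⟨n - 1, by have := h.three_le; omega⟩
      have : i + (n + 1 - 1) * k + k = i + (n + 1) * k := by
        rw [Nat.add_sub_cancel]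
        ring
      rw [this]
      simp [Nat.ModEq]
    rw [hi, hk, (h.eq_iff _ _).2 hmod, (h.eq_iff _ _).2 (hmod.add_right 1)]
  · simpa only [hk] using h.mem_edges (i + k)

lemma eq_iff_of_lt (h : IsUniqueCycle G n c) {i j : ℕ} (hi : i < n) (hj : j < n) :
    c i = c j ↔ i = j := by
  rw [h.eq_iff, Nat.ModEq, Nat.mod_eq_of_lt hi, Nat.mod_eq_of_lt hj]

lemma apply_length (h : IsUniqueCycle G n c) : c n = c 0 := by
  rw [h.eq_iff]
  simp [Nat.ModEq]

lemma exists_lt_eq (h : IsUniqueCycle G n c) {p q : V} (hpq : G.Adj p q)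
    (hb : ¬ G.IsBridge s(p, q)) : ∃ i < n, s(p, q) = s(c i, c (i + 1)) := by
  obtain ⟨i, hi⟩ := h.exists_eq p q hpq hb
  have hmod : i % n ≡ i [MOD n] := Nat.mod_modEq _ _
  exact ⟨i % n, Nat.mod_lt _ (by have := h.three_le; omega), by
    rw [hi, (h.eq_iff _ _).2 hmod, (h.eq_iff _ _).2 (hmod.add_right 1)]⟩

lemma reachable_deleteEdges (h : IsUniqueCycle G n c) {p q : V} (hb : G.IsBridge s(p, q))
    (i : ℕ) : (G.deleteEdges {s(p, q)}).Reachable (c 0) (c i) := by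
  induction i with
  | zero => rfl
  | succ i ih =>
    refine ih.trans (SimpleGraph.Adj.reachable ?_)
    rw [SimpleGraph.deleteEdges_adj]
    refine ⟨h.adj i, fun heq => h.not_isBridge i ?_⟩
    rw [Set.mem_singleton_iff] at heq
    rwa [heq]

/-- An edge spanned by the cycle and by two further edges meeting it is one of those edges. -/
lemma eq_of_adj (h : IsUniqueCycle G n c) {i j : ℕ} {t t' p q : V} (ht : G.Adj (c i) t)
    (ht' : G.Adj (c j) t') (hpq : G.Adj p q) (hp : p ∈ Set.range c ∨ p = t ∨ p = t')
    (hq : q ∈ Set.range c ∨ q = t ∨ q = t') :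
    s(p, q) = s(c i, t) ∨ s(p, q) = s(c j, t') ∨ ∃ k < n, s(p, q) = s(c k, c (k + 1)) := by
  by_contra! hne
  by_cases hb : G.IsBridge s(p, q)
  · have hr := h.reachable_deleteEdges hb
    have hrt : (G.deleteEdges {s(p, q)}).Reachable (c 0) t :=
      (hr i).trans (SimpleGraph.Adj.reachable (by
        rw [SimpleGraph.deleteEdges_adj]
        exact ⟨ht, fun heq => hne.1 (Set.mem_singleton_iff.1 heq).symm⟩))
    have hrt' : (G.deleteEdges {s(p, q)}).Reachable (c 0) t' :=
      (hr j).trans (SimpleGraph.Adj.reachable (by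
        rw [SimpleGraph.deleteEdges_adj]
        exact ⟨ht', fun heq => hne.2.1 (Set.mem_singleton_iff.1 heq).symm⟩))
    have key : ∀ z, (z ∈ Set.range c ∨ z = t ∨ z = t') →
        (G.deleteEdges {s(p, q)}).Reachable (c 0) z := by
      rintro z (⟨k, rfl⟩ | rfl | rfl)
      exacts [hr k, hrt, hrt']
    exact (SimpleGraph.isBridge_iff.1 hb) ((key p hp).symm.trans (key q hq))
  · obtain ⟨k, hk, heq⟩ := h.exists_lt_eq hpq hb
    exact hne.2.2 k hk heq

lemma adj_pred (h : IsUniqueCycle G n c) (i : ℕ) : G.Adj (c i) (c (i + (n - 1))) := by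
  have := h.adj (i + (n - 1))
  have hn := h.three_le
  rw [show i + (n - 1) + 1 = i + n by omega, (h.eq_iff (i + n) i).2 (by simp [Nat.ModEq])] at this
  exact this.symm

lemma notMem_range (h : IsUniqueCycle G n c) {i : ℕ} {t : V} (ht : G.Adj (c i) t)
    (ht1 : t ≠ c (i + 1)) (ht2 : t ≠ c (i + (n - 1))) : t ∉ Set.range c := by
  rintro ⟨j, rfl⟩
  have hn := h.three_le
  by_cases hb : G.IsBridge s(c i, c j)
  · have hr := h.reachable_deleteEdges hb
    exact (SimpleGraph.isBridge_iff.1 hb) ((hr i).symm.trans (hr j))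
  · obtain ⟨k, hk⟩ := h.exists_eq _ _ ht hb
    rcases Sym2.eq_iff.1 hk with ⟨h1, h2⟩ | ⟨h1, h2⟩
    · refine ht1 (h2.trans ?_)
      rw [h.eq_iff] at h1 ⊢
      exact (h1.add_right 1).symm
    · refine ht2 (h2.trans ?_)
      rw [h.eq_iff] at h1 ⊢
      have := h1.add_right (n - 1)
      rw [show k + 1 + (n - 1) = k + n by omega] at this
      simpa [Nat.ModEq] using this.symm

lemma ne_of_adj_notMem_range (h : IsUniqueCycle G n c) {i j : ℕ} {t t' : V} (hij : c i ≠ c j)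
    (ht : G.Adj (c i) t) (ht' : G.Adj (c j) t') (hoff : t ∉ Set.range c) : t ≠ t' := by
  rintro rfl
  have hb : G.IsBridge s(c i, t) := by
    by_contra hb
    obtain ⟨k, hk⟩ := h.exists_eq _ _ ht hb
    rcases Sym2.eq_iff.1 hk with ⟨_, h2⟩ | ⟨_, h2⟩
    · exact hoff ⟨_, h2.symm⟩
    · exact hoff ⟨_, h2.symm⟩
  have hr := h.reachable_deleteEdges hb
  refine (SimpleGraph.isBridge_iff.1 hb) (((hr i).symm.trans (hr j)).trans
    (SimpleGraph.Adj.reachable ?_))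
  rw [SimpleGraph.deleteEdges_adj]
  refine ⟨ht', fun heq => ?_⟩
  rcases Sym2.eq_iff.1 (Set.mem_singleton_iff.1 heq) with ⟨h1, _⟩ | ⟨h1, _⟩
  · exact hij h1.symm
  · exact ht'.ne h1

lemma succ_ne_pred (h : IsUniqueCycle G n c) (i : ℕ) : c (i + 1) ≠ c (i + (n - 1)) := by
  have hn := h.three_le
  rw [Ne, h.eq_iff]
  intro hmod
  have := Nat.ModEq.add_left_cancel' i hmod
  rw [Nat.ModEq, Nat.mod_eq_of_lt (by omega), Nat.mod_eq_of_lt (by omega)] at this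
  omega

variable [Fintype V] [DecidableEq V] [DecidableRel G.Adj]

lemma degree_eq_two_iff (h : IsUniqueCycle G n c) (i : ℕ) :
    G.degree (c i) = 2 ↔ ∀ t, G.Adj (c i) t → t = c (i + 1) ∨ t = c (i + (n - 1)) := by
  have hsub : ({c (i + 1), c (i + (n - 1))} : Finset V) ⊆ G.neighborFinset (c i) := by
    intro z hz
    rw [SimpleGraph.mem_neighborFinset]
    rcases Finset.mem_insert.1 hz with rfl | hz
    · exact h.adj i
    · rw [Finset.mem_singleton.1 hz]
      exact h.adj_pred i
  have hcard := Finset.card_pair (h.succ_ne_pred i)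
  rw [← SimpleGraph.card_neighborFinset_eq_degree]
  constructor
  · intro h2 t ht
    have heq := Finset.eq_of_subset_of_card_le hsub (by rw [hcard, h2])
    have : t ∈ ({c (i + 1), c (i + (n - 1))} : Finset V) := by
      rw [heq]
      simpa using ht
    simpa using this
  · intro hall
    rw [← hcard]
    congr 1
    refine Finset.Subset.antisymm (fun t ht => ?_) hsub
    simpa using hall t (by simpa using ht)

lemma exists_notMem_range (h : IsUniqueCycle G n c) {i : ℕ} (hi : G.degree (c i) ≠ 2) :
    ∃ t, G.Adj (c i) t ∧ t ∉ Set.range c := by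
  rw [Ne, h.degree_eq_two_iff] at hi
  push Not at hi
  obtain ⟨t, ht, h1, h2⟩ := hi
  exact ⟨t, ht, h.notMem_range ht h1 h2⟩

end IsUniqueCycle

end Unicyclic

section Necessity

variable {V : Type*} [DecidableEq V] {G : SimpleGraph V} {n : ℕ} {c : ℕ → V}

lemma pair_eq_of_sym2_eq {p q a b : V} (h : s(p, q) = s(a, b)) :
    ({p, q} : Finset V) = {a, b} := by
  rcases Sym2.eq_iff.1 h with ⟨rfl, rfl⟩ | ⟨rfl, rfl⟩
  · rfl
  · exact Finset.pair_comm _ _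

/-- The conclusion of `bridgeFriendly_unicyclic_iff`, in terms of a parametrization of the
cycle. -/
def HasOppositeDegreeTwo (G : SimpleGraph V) [Fintype V] [DecidableRel G.Adj] (n : ℕ)
    (c : ℕ → V) : Prop :=
  ((n = 3 ∨ n = 5) ∧ ∃ i, G.degree (c i) = 2) ∨
    (n = 6 ∧ ∃ i, G.degree (c i) = 2 ∧ G.degree (c (i + 3)) = 2)

namespace IsUniqueCycle

lemma not_forall_type2 (h : IsUniqueCycle G n c) {ord : Finset V → ℕ} {t t' : V}
    (ht : G.Adj (c (n - 1)) t) (ht' : G.Adj (c 2) t') (ht0 : t ≠ c 0) (ht1 : t ≠ c 1)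
    (ht0' : t' ≠ c 0) (ht1' : t' ≠ c 1)
    (hend : ({c (n - 1), t} : Finset V) = {c 2, t'} ∨
      Disjoint ({c (n - 1), t} : Finset V) {c 2, t'})
    (hk : ∀ k, 2 ≤ k → k + 1 < n → (k = 2 ∨ c k = t ∨ c k = t') →
      (k + 2 = n ∨ c (k + 1) = t ∨ c (k + 1) = t') →
      s(c k, c (k + 1)) = s(c (n - 1), t) ∨ s(c k, c (k + 1)) = s(c 2, t'))
    (hlt : ord {c 0, c 1} < ord {c 0, c (n - 1)}) (hlt' : ord {c 0, c 1} < ord {c 1, c 2}) :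
    ¬ ∀ σ : Finset (Finset V), ↑σ ⊆ edgeSets G → PotType2 (edgeSets G) ord σ →
      Type2 (edgeSets G) ord σ := by
  have hn := h.three_le
  have hinj : ∀ {i j : ℕ}, i < n → j < n → (c i = c j ↔ i = j) := fun hi hj =>
    h.eq_iff_of_lt hi hj
  have hpred : G.Adj (c 0) (c (n - 1)) := by simpa using h.adj_pred 0
  refine not_forall_type2_of_path (h.adj 0) hpred (h.adj 1) ht ht' ?_ ?_ ht0 ht1 ht0' ht1' hend
    ?_ hlt hlt'
  · rw [zero_add, Ne, hinj (by omega) (by omega)]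
    omega
  · rw [Ne, hinj (by omega) (by omega)]
    omega
  · intro p q hpq hp hq
    have hrange : ∀ z ∈ ({c 0, c (0 + 1), c (n - 1), c (1 + 1), t, t'} : Finset V),
        z ∈ Set.range c ∨ z = t ∨ z = t' := by
      intro z hz
      simp only [Finset.mem_insert, Finset.mem_singleton] at hz
      rcases hz with rfl | rfl | rfl | rfl | rfl | rfl <;> simp
    simp only [Finset.mem_insert, Finset.mem_singleton]
    have main : ∀ k < n, s(p, q) = s(c k, c (k + 1)) → s(p, q) = s(c 0, c 1) ∨
        s(p, q) = s(c 0, c (n - 1)) ∨ s(p, q) = s(c 1, c 2) ∨ s(p, q) = s(c (n - 1), t) ∨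
        s(p, q) = s(c 2, t') := by
      intro k hkn heq
      have hmem : c k ∈ ({c 0, c (0 + 1), c (n - 1), c (1 + 1), t, t'} : Finset V) ∧
          c (k + 1) ∈ ({c 0, c (0 + 1), c (n - 1), c (1 + 1), t, t'} : Finset V) := by
        rcases Sym2.eq_iff.1 heq with ⟨h1, h2⟩ | ⟨h1, h2⟩
        · exact ⟨h1 ▸ hp, h2 ▸ hq⟩
        · exact ⟨h2 ▸ hq, h1 ▸ hp⟩
      rw [heq]
      rcases Nat.lt_or_ge k 2 with h2 | h2
      · interval_cases k
        · exact Or.inl rfl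
        · exact Or.inr (Or.inr (Or.inl rfl))
      · rcases Nat.lt_or_ge (k + 1) n with h3 | h3
        · refine Or.inr (Or.inr (Or.inr (hk k h2 h3 ?_ ?_)))
          · have := hmem.1
            simp only [Finset.mem_insert, Finset.mem_singleton] at this
            rw [hinj hkn (by omega), hinj hkn (by omega), hinj hkn (by omega),
              hinj hkn (by omega)] at this
            rcases this with h | h | h | h | h | h
            iterate 3 omega
            exacts [Or.inl h, Or.inr (Or.inl h), Or.inr (Or.inr h)]
          · have := hmem.2
            simp only [Finset.mem_insert, Finset.mem_singleton] at this
            rw [hinj h3 (by omega), hinj h3 (by omega), hinj h3 (by omega),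
              hinj h3 (by omega)] at this
            rcases this with h | h | h | h | h | h
            iterate 2 omega
            · exact Or.inl (by omega)
            · omega
            exacts [Or.inr (Or.inl h), Or.inr (Or.inr h)]
        · obtain rfl : k = n - 1 := by omega
          rw [show n - 1 + 1 = n by omega, h.apply_length]
          exact Or.inr (Or.inl Sym2.eq_swap)
    have hmain : s(p, q) = s(c 0, c 1) ∨
        s(p, q) = s(c 0, c (n - 1)) ∨ s(p, q) = s(c 1, c 2) ∨ s(p, q) = s(c (n - 1), t) ∨
        s(p, q) = s(c 2, t') := by
      rcases h.eq_of_adj ht ht' hpq (hrange p hp) (hrange q hq) with heq | heq | ⟨k, hkn, heq⟩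
      · exact Or.inr (Or.inr (Or.inr (Or.inl heq)))
      · exact Or.inr (Or.inr (Or.inr (Or.inr heq)))
      · exact main k hkn heq
    exact hmain.imp pair_eq_of_sym2_eq (.imp pair_eq_of_sym2_eq (.imp pair_eq_of_sym2_eq
      (.imp pair_eq_of_sym2_eq pair_eq_of_sym2_eq)))

variable [Fintype V] [DecidableRel G.Adj]

lemma hasOppositeDegreeTwo_of_lt (h : IsUniqueCycle G n c) {ord : Finset V → ℕ}
    (hord : ∀ σ : Finset (Finset V), ↑σ ⊆ edgeSets G → PotType2 (edgeSets G) ord σ →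
      Type2 (edgeSets G) ord σ)
    (hlt : ord {c 0, c 1} < ord {c 0, c (n - 1)}) (hlt' : ord {c 0, c 1} < ord {c 1, c 2}) :
    HasOppositeDegreeTwo G n c := by
  have hn := h.three_le
  have hinj : ∀ {i j : ℕ}, i < n → j < n → (c i = c j ↔ i = j) := fun hi hj =>
    h.eq_iff_of_lt hi hj
  have hoff : ∀ {t : V}, t ∉ Set.range c → ∀ i, t ≠ c i := by
    rintro t ht i rfl
    exact ht ⟨i, rfl⟩
  have hbefore : 4 ≤ n → G.Adj (c (n - 1)) (c (n - 2)) := by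
    intro h4
    have := h.adj (n - 2)
    rw [show n - 2 + 1 = n - 1 by omega] at this
    exact this.symm
  by_contra hcon
  simp only [HasOppositeDegreeTwo, not_or, not_and, not_exists] at hcon
  obtain ⟨hodd, hsix⟩ := hcon
  obtain rfl | rfl | rfl | rfl | h7 : n = 3 ∨ n = 4 ∨ n = 5 ∨ n = 6 ∨ 7 ≤ n := by omega
  · obtain ⟨t, ht, hto⟩ := h.exists_notMem_range (hodd (by simp) 2)
    exact h.not_forall_type2 ht ht (hoff hto 0) (hoff hto 1) (hoff hto 0) (hoff hto 1)
      (Or.inl rfl) (by omega) hlt hlt' hord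
  · have h23 : c 2 ≠ c 3 := (h.adj 2).ne
    refine h.not_forall_type2 (t := c 2) (t' := c 3) (h.adj 2).symm (h.adj 2) ?_ ?_ ?_ ?_
      (Or.inl (Finset.pair_comm _ _)) ?_ hlt hlt' hord
    iterate 4
      rw [Ne, hinj (by omega) (by omega)]
      omega
    intro k h2 h3 _ _
    obtain rfl : k = 2 := by omega
    exact Or.inr rfl
  · obtain ⟨t, ht, hto⟩ := h.exists_notMem_range (hodd (by simp) 4)
    obtain ⟨t', ht', hto'⟩ := h.exists_notMem_range (hodd (by simp) 2)
    have h42 : c 4 ≠ c 2 := by simp [hinj]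
    have htt := h.ne_of_adj_notMem_range h42 ht ht' hto
    refine h.not_forall_type2 ht ht' (hoff hto 0) (hoff hto 1) (hoff hto' 0) (hoff hto' 1)
      (Or.inr ?_) ?_ hlt hlt' hord
    · simp [h42.symm, htt.symm, (hoff hto _).symm, hoff hto']
    · intro k h2 h3 hk hk'
      simp only [(hoff hto _).symm, (hoff hto' _).symm, or_false] at hk hk'
      omega
  · by_cases hd : G.degree (c 2) = 2
    · obtain ⟨t, ht, hto⟩ := h.exists_notMem_range (hsix rfl 2 hd)
      refine h.not_forall_type2 (t' := c 3) ht (h.adj 2) (hoff hto 0) (hoff hto 1) ?_ ?_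
        (Or.inr ?_) ?_ hlt hlt' hord
      iterate 2
        rw [Ne, hinj (by omega) (by omega)]
        omega
      · simp [(hoff hto _).symm, hinj]
      · intro k h2 h3 hk hk'
        simp only [(hoff hto _).symm, false_or] at hk hk'
        rw [hinj (by omega) (by omega)] at hk hk'
        obtain rfl : k = 2 := by omega
        exact Or.inr rfl
    · obtain ⟨t', ht', hto'⟩ := h.exists_notMem_range hd
      refine h.not_forall_type2 (t := c 4) (hbefore (by omega)) ht' ?_ ?_ (hoff hto' 0)
        (hoff hto' 1) (Or.inr ?_) ?_ hlt hlt' hord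
      iterate 2
        rw [Ne, hinj (by omega) (by omega)]
        omega
      · simp [hoff hto', hinj]
      · intro k h2 h3 hk hk'
        simp only [(hoff hto' _).symm, or_false] at hk hk'
        rw [hinj (by omega) (by omega)] at hk hk'
        obtain rfl : k = 4 := by omega
        exact Or.inl Sym2.eq_swap
  · refine h.not_forall_type2 (t := c (n - 2)) (t' := c 3) (hbefore (by omega)) (h.adj 2) ?_ ?_
      ?_ ?_ (Or.inr ?_) ?_ hlt hlt' hord
    iterate 4
      rw [Ne, hinj (by omega) (by omega)]
      omega
    · simp only [Finset.disjoint_left, Finset.mem_insert, Finset.mem_singleton]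
      rintro z (rfl | rfl) <;>
        · rw [hinj (by omega) (by omega), hinj (by omega) (by omega)]
          omega
    · intro k h2 h3 hk hk'
      rw [hinj (by omega) (by omega), hinj (by omega) (by omega)] at hk hk'
      obtain rfl | rfl : k = 2 ∨ k = n - 2 := by omega
      · exact Or.inr rfl
      · rw [show n - 2 + 1 = n - 1 by omega]
        exact Or.inl Sym2.eq_swap

lemma hasOppositeDegreeTwo (h : IsUniqueCycle G n c) (hG : BridgeFriendly (edgeSets G)) :
    HasOppositeDegreeTwo G n c := by
  obtain ⟨ord, hinj, hord⟩ := hG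
  have hn := h.three_le
  obtain ⟨k, hk, hmin⟩ := (Finset.range n).exists_min_image (fun i => ord {c i, c (i + 1)})
    ⟨0, by simp; omega⟩
  have hmin' : ∀ i, ord {c k, c (k + 1)} ≤ ord {c i, c (i + 1)} := by
    intro i
    have hmod : i % n ≡ i [MOD n] := Nat.mod_modEq _ _
    have := hmin (i % n) (Finset.mem_range.2 (Nat.mod_lt _ (by omega)))
    rwa [(h.eq_iff _ _).2 hmod, (h.eq_iff _ _).2 (hmod.add_right 1)] at this
  have hs := h.shift k
  have hpair : ∀ {a b a' b' : V}, G.Adj a b → G.Adj a' b' → a' ≠ a → a' ≠ b →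
      ord {a, b} ≤ ord {a', b'} → ord {a, b} < ord {a', b'} := by
    intro a b a' b' hab hab' h1 h2 hle
    refine lt_of_le_of_ne hle fun heq => ?_
    have heq := hinj (pair_mem_edgeSets.2 hab) (pair_mem_edgeSets.2 hab') heq
    have : a' ∈ ({a, b} : Finset V) := by simp [heq]
    simp [h1, h2] at this
  have key : HasOppositeDegreeTwo G n fun i => c (i + k) := by
    refine hs.hasOppositeDegreeTwo_of_lt (ord := ord) hord ?_ ?_
    · rw [Finset.pair_comm (c (0 + k)) (c (n - 1 + k))]
      refine hpair (hs.adj 0) ?_ ?_ ?_ ?_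
      · simpa using (hs.adj_pred 0).symm
      · rw [Ne, hs.eq_iff_of_lt (i := n - 1) (j := 0) (by omega) (by omega)]
        omega
      · rw [Ne, hs.eq_iff_of_lt (i := n - 1) (j := 1) (by omega) (by omega)]
        omega
      · have hlast : c (0 + k) = c (n - 1 + k + 1) := by
          rw [h.eq_iff, show n - 1 + k + 1 = 0 + k + n by omega]
          simp [Nat.ModEq]
        have := hmin' (n - 1 + k)
        rwa [← hlast, Nat.add_comm k, ← congrArg c (zero_add k)] at this
    · rw [Finset.pair_comm (c (1 + k)) (c (2 + k))]
      refine hpair (hs.adj 0) (hs.adj 1).symm ?_ ?_ ?_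
      · rw [Ne, hs.eq_iff_of_lt (i := 2) (j := 0) (by omega) (by omega)]
        omega
      · rw [Ne, hs.eq_iff_of_lt (i := 2) (j := 1) (by omega) (by omega)]
        omega
      · have := hmin' (1 + k)
        rw [Finset.pair_comm (c (2 + k))]
        rwa [show 1 + k + 1 = 2 + k by omega, Nat.add_comm k, ← congrArg c (zero_add k)] at this
  rcases key with ⟨h1, i, hi⟩ | ⟨h1, i, hi, hi'⟩
  · exact Or.inl ⟨h1, _, hi⟩
  · refine Or.inr ⟨h1, i + k, hi, ?_⟩
    rwa [show i + k + 3 = i + 3 + k by omega]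

end IsUniqueCycle

end Necessity

section Sufficiency

variable {V : Type*} {G : SimpleGraph V} {n : ℕ} {c : ℕ → V}

/-- `d` is the distance from `c 0` in the spanning tree which omits the edge joining
`c (n - 1)` to `c 0`. -/
structure IsDepth (G : SimpleGraph V) (n : ℕ) (c : ℕ → V) (d : V → ℕ) : Prop where
  apply_cycle : ∀ i < n, d (c i) = i
  step : ∀ {p q : V}, G.Adj p q → s(p, q) ≠ s(c 0, c (n - 1)) → d p = d q + 1 ∨ d q = d p + 1
  eq_of_adj : ∀ {z p q : V}, G.Adj z p → G.Adj z q → d z = d p + 1 → d z = d q + 1 → p = q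

lemma SimpleGraph.IsAcyclic.eq_of_dist_eq_add_one {T : SimpleGraph V} (hT : T.IsAcyclic)
    {a z p q : V} (hp : T.Adj z p) (hq : T.Adj z q) (hz : T.Reachable a z)
    (hdp : T.dist a z = T.dist a p + 1) (hdq : T.dist a z = T.dist a q + 1) : p = q := by
  obtain ⟨w, hw⟩ := (hz.trans hp.reachable).exists_walk_length_eq_dist
  obtain ⟨w', hw'⟩ := (hz.trans hq.reachable).exists_walk_length_eq_dist
  have h := Walk.isPath_of_length_eq_dist (w.concat hp.symm) (by rw [Walk.length_concat]; omega)
  have h' := Walk.isPath_of_length_eq_dist (w'.concat hq.symm) (by rw [Walk.length_concat]; omega)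
  have heq : w.concat hp.symm = w'.concat hq.symm :=
    congrArg Subtype.val ((hT.subsingleton_path a z).elim ⟨_, h⟩ ⟨_, h'⟩)
  simpa using congrArg Walk.penultimate heq

lemma IsUniqueCycle.exists_isDepth (h : IsUniqueCycle G n c) (hconn : G.Connected) :
    ∃ d, IsDepth G n c d := by
  have hn := h.three_le
  have hlast : s(c (n - 1), c (n - 1 + 1)) = s(c 0, c (n - 1)) := by
    rw [show n - 1 + 1 = n by omega, h.apply_length, Sym2.eq_swap]
  have hnb : ¬ G.IsBridge s(c 0, c (n - 1)) := hlast ▸ h.not_isBridge (n - 1)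
  set T := G.deleteEdges {s(c 0, c (n - 1))} with hTdef
  have hTconn : T.Connected := hconn.connected_delete_edge_of_not_isBridge hnb
  have hTadj : ∀ {p q : V}, T.Adj p q ↔ G.Adj p q ∧ s(p, q) ≠ s(c 0, c (n - 1)) := by
    simp [hTdef, SimpleGraph.deleteEdges_adj]
  have hTacyc : T.IsAcyclic := by
    intro u w hw
    have hmem := h.mem_edges (n - 1) u _ (hw.mapLe (SimpleGraph.deleteEdges_le _))
    rw [SimpleGraph.Walk.edges_mapLe_eq_edges, hlast] at hmem
    exact (hTadj.1 (w.adj_of_mem_edges hmem)).2 rfl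
  have hstep : ∀ {p q : V}, G.Adj p q → s(p, q) ≠ s(c 0, c (n - 1)) →
      T.dist (c 0) p = T.dist (c 0) q + 1 ∨ T.dist (c 0) q = T.dist (c 0) p + 1 :=
    fun hpq hne => hTacyc.dist_eq_dist_add_one_of_adj_of_reachable _ (hTadj.2 ⟨hpq, hne⟩)
      (hTconn _ _)
  have huniq : ∀ {z p q : V}, T.Adj z p → T.Adj z q → T.dist (c 0) z = T.dist (c 0) p + 1 →
      T.dist (c 0) z = T.dist (c 0) q + 1 → p = q :=
    fun hp hq => hTacyc.eq_of_dist_eq_add_one hp hq (hTconn _ _)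
  have hTc : ∀ i, i + 1 < n → T.Adj (c i) (c (i + 1)) := by
    intro i hi
    refine hTadj.2 ⟨h.adj i, fun heq => ?_⟩
    rcases Sym2.eq_iff.1 heq with ⟨h1, h2⟩ | ⟨h1, -⟩
    · rw [h.eq_iff_of_lt (by omega) (by omega)] at h1 h2
      omega
    · rw [h.eq_iff_of_lt (by omega) (by omega)] at h1
      omega
  have hcyc : ∀ i < n, T.dist (c 0) (c i) = i := by
    intro i
    induction i using Nat.strong_induction_on with
    | _ i ih =>
      intro hi
      obtain rfl | rfl | ⟨j, rfl⟩ : i = 0 ∨ i = 1 ∨ ∃ j, i = j + 2 := by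
        rcases i with _ | _ | j
        exacts [Or.inl rfl, Or.inr (Or.inl rfl), Or.inr (Or.inr ⟨j, rfl⟩)]
      · exact SimpleGraph.dist_self
      · exact SimpleGraph.dist_eq_one_iff_adj.2 (hTc 0 hi)
      · have h0 := ih j (by omega) (by omega)
        have h1 := ih (j + 1) (by omega) (by omega)
        have hadj := hTadj.1 (hTc (j + 1) hi)
        rcases hstep hadj.1 hadj.2 with h2 | h2
        · have := huniq (hTc j (by omega)).symm (hTc (j + 1) hi) (by omega) h2
          rw [h.eq_iff_of_lt (by omega) (by omega)] at this
          omega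
        · rw [h2, h1]
  have hd0 : T.dist (c 0) (c 0) = 0 := SimpleGraph.dist_self
  have hdl : T.dist (c 0) (c (n - 1)) = n - 1 := hcyc _ (by omega)
  refine ⟨T.dist (c 0), hcyc, hstep, ?_⟩
  have hT : ∀ {z p : V}, G.Adj z p → T.dist (c 0) z = T.dist (c 0) p + 1 → T.Adj z p := by
    intro z p hzp hd
    refine hTadj.2 ⟨hzp, fun heq => ?_⟩
    rcases Sym2.eq_iff.1 heq with ⟨rfl, rfl⟩ | ⟨rfl, rfl⟩ <;> omega
  exact @fun z p q hp hq hdp hdq => huniq (hT hp hdp) (hT hq hdq) hdp hdq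

lemma exists_injective_strictMono_rank {α : Type*} [Finite α] (r : α → ℕ) :
    ∃ ord : α → ℕ, Function.Injective ord ∧ ∀ a b, r a < r b → ord a < ord b := by
  obtain ⟨N, ⟨e⟩⟩ := Finite.exists_equiv_fin α
  refine ⟨fun a => r a * N + e a, fun a b hab => ?_, fun a b hab => ?_⟩
  · have ha := (e a).isLt
    have hb := (e b).isLt
    have hmod : ∀ a : α, (r a * N + e a) % N = e a := fun a => by
      rw [Nat.mul_add_mod_self_right, Nat.mod_eq_of_lt (e a).isLt]
    exact e.injective (Fin.ext (by rw [← hmod a, ← hmod b]; exact congrArg (· % N) hab))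
  · have ha := (e a).isLt
    have : (r a + 1) * N ≤ r b * N := Nat.mul_le_mul_right N hab
    simp only
    linarith [Nat.zero_le (e b : ℕ), add_mul (r a) 1 N]

/-- The order puts `b` first, then prefers edges of small depth, and among edges of the same
depth those of `C`. -/
structure IsDepthOrder (d : V → ℕ) (b : Finset V) (C : Set (Finset V)) (ord : Finset V → ℕ) :
    Prop where
  injective : Function.Injective ord
  lt_top : ∀ s, s ≠ b → ord s < ord b
  lt_of_sup_lt : ∀ s t, t ≠ b → s.sup d < t.sup d → ord t < ord s
  lt_of_notMem : ∀ s t, t ≠ b → s.sup d = t.sup d → s ∈ C → t ∉ C → ord t < ord s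

lemma exists_isDepthOrder [Finite V] (d : V → ℕ) (b : Finset V) (C : Set (Finset V)) :
    ∃ ord, IsDepthOrder d b C ord := by
  classical
  have := Fintype.ofFinite V
  set D := Finset.univ.sup d
  have hD : ∀ s : Finset V, s.sup d ≤ D := fun s => Finset.sup_mono (Finset.subset_univ s)
  obtain ⟨ord, hinj, hord⟩ := exists_injective_strictMono_rank fun s : Finset V =>
    if s = b then 2 * D + 2 else 2 * (D - s.sup d) + if s ∈ C then 1 else 0
  refine ⟨ord, hinj, fun s hs => hord _ _ ?_, fun s t ht hst => hord _ _ ?_,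
    fun s t ht hst hs ht' => hord _ _ ?_⟩
  · simp only [hs, if_true, if_false]
    split_ifs <;> omega
  · have := hD t
    have := hD s
    simp only [ht, if_false]
    split_ifs <;> omega
  · have := hD t
    simp only [ht, hs, ht', hst, if_true, if_false]
    split_ifs <;> omega

end Sufficiency

section Sufficiency

variable {V : Type*} [DecidableEq V] {G : SimpleGraph V} {n : ℕ} {c : ℕ → V} {d : V → ℕ}
  {ord : Finset V → ℕ} {τ : Finset (Finset V)}

namespace IsUniqueCycle

lemma eq_of_badPath_of_lt (h : IsUniqueCycle G n c) (hd : IsDepth G n c d)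
    (hord : IsDepthOrder d {c 0, c (n - 1)}
      {{c (n - 1), c (n - 2)}, {c (n - 2), c (n - 3)}} ord) {x y u v : V}
    (hbad : BadPath G ord τ x y u v) (hxy : d x = d y + 1) :
    x = c (n - 1) ∧ y = c (n - 2) ∧ u = c 0 ∧ v = c (n - 3) := by
  have hn := h.three_le
  have hd0 := hd.apply_cycle 0 (by omega)
  have hd1 := hd.apply_cycle (n - 1) (by omega)
  have hd2 := hd.apply_cycle (n - 2) (by omega)
  have hd3 := hd.apply_cycle (n - 3) (by omega)
  have h21 : G.Adj (c (n - 2)) (c (n - 1)) := by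
    simpa only [show n - 2 + 1 = n - 1 by omega] using h.adj (n - 2)
  have h32 : G.Adj (c (n - 3)) (c (n - 2)) := by
    simpa only [show n - 3 + 1 = n - 2 by omega] using h.adj (n - 3)
  have hxu : s(x, u) = s(c 0, c (n - 1)) := by
    by_contra hne
    rcases hd.step hbad.adj_left hne with h1 | h1
    · exact hbad.ne_left (hd.eq_of_adj hbad.adj_left hbad.adj h1 hxy)
    · refine (hord.lt_of_sup_lt {x, y} {x, u} ?_ ?_).not_gt hbad.lt_left
      · intro heq
        have hx : x ∈ ({c 0, c (n - 1)} : Finset V) := by simp [← heq]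
        have hu : u ∈ ({c 0, c (n - 1)} : Finset V) := by simp [← heq]
        simp only [Finset.mem_insert, Finset.mem_singleton] at hx hu
        rcases hx with rfl | rfl <;> rcases hu with rfl | rfl
        · omega
        · exact hne rfl
        · omega
        · omega
      · simp only [Finset.sup_insert, Finset.sup_singleton]
        omega
  obtain ⟨rfl, rfl⟩ : x = c (n - 1) ∧ u = c 0 := by
    rcases Sym2.eq_iff.1 hxu with ⟨rfl, -⟩ | h
    · omega
    · exact h
  obtain rfl : y = c (n - 2) := hd.eq_of_adj hbad.adj h21.symm hxy (by omega)
  refine ⟨rfl, rfl, rfl, ?_⟩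
  have hyv := hbad.symm.adj_left
  have hvx := hbad.symm.ne_left
  have hne : s(c (n - 2), v) ≠ s(c 0, c (n - 1)) := by
    intro heq
    rcases Sym2.eq_iff.1 heq with ⟨-, h2⟩ | ⟨h1, -⟩
    · exact hvx h2
    · exact h21.ne h1
  rcases hd.step hyv hne with h1 | h1
  · exact hd.eq_of_adj hyv h32.symm h1 (by omega)
  · exfalso
    have hmem : ∀ {a b : V}, ({c (n - 2), v} : Finset V) = {a, b} → v = a ∨ v = b := by
      intro a b heq
      have : v ∈ ({a, b} : Finset V) := by simp [← heq]
      simpa using this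
    refine (hord.lt_of_notMem {c (n - 1), c (n - 2)} {c (n - 2), v} ?_ ?_ (Or.inl rfl)
      ?_).not_gt hbad.lt_right
    · intro heq
      rcases hmem heq with rfl | rfl
      · omega
      · exact hvx rfl
    · simp only [Finset.sup_insert, Finset.sup_singleton]
      omega
    · rintro (heq | heq)
      · rcases hmem heq with rfl | rfl
        · exact hvx rfl
        · omega
      · rcases hmem (Set.mem_singleton_iff.1 heq) with rfl | rfl <;> omega

lemma exists_badPath_cycle (h : IsUniqueCycle G n c) (hd : IsDepth G n c d)
    (hord : IsDepthOrder d {c 0, c (n - 1)}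
      {{c (n - 1), c (n - 2)}, {c (n - 2), c (n - 3)}} ord)
    (hG : ¬ BridgeFriendly (edgeSets G)) :
    ∃ τ, BadPath G ord τ (c (n - 1)) (c (n - 2)) (c 0) (c (n - 3)) := by
  obtain ⟨τ, x, y, u, v, hbad⟩ := exists_badPath hord.injective.injOn hG
  have hne : s(x, y) ≠ s(c 0, c (n - 1)) := by
    intro heq
    refine (hord.lt_top {x, u} ?_).not_gt ?_
    · intro heq'
      have := hbad.lt_left
      rw [pair_eq_of_sym2_eq heq, heq'] at this
      exact lt_irrefl _ this
    · rw [← pair_eq_of_sym2_eq heq]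
      exact hbad.lt_left
  rcases hd.step hbad.adj hne with hxy | hxy
  · obtain ⟨rfl, rfl, rfl, rfl⟩ := h.eq_of_badPath_of_lt hd hord hbad hxy
    exact ⟨τ, hbad⟩
  · obtain ⟨rfl, rfl, rfl, rfl⟩ := h.eq_of_badPath_of_lt hd hord hbad.symm hxy
    exact ⟨τ, hbad.symm⟩

variable [Fintype V] [DecidableRel G.Adj]

lemma pair_mem_of_badPath (h : IsUniqueCycle G n c) (h0 : G.degree (c 0) = 2) {y v : V}
    (hbad : BadPath G ord τ (c (n - 1)) y (c 0) v) : {c 0, c 1} ∈ τ := by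
  obtain ⟨e, he, h0e⟩ := hbad.left.cover (c 0) (by simp)
  obtain ⟨w, hw, rfl⟩ := exists_eq_pair_of_mem (hbad.sub he) h0e
  rcases (h.degree_eq_two_iff 0).1 h0 w hw with rfl | rfl
  · simpa using he
  · rw [zero_add, Finset.pair_comm] at he
    exact absurd he hbad.left.notMem

/-- The gap `{c 1, c 2}` turns the only edge of `τ` at `c 2` into a bridge. -/
lemma exists_isBridge_of_badPath (h : IsUniqueCycle G n c) (hn : 5 ≤ n) (hd : IsDepth G n c d)
    {C : Set (Finset V)} (hord : IsDepthOrder d {c 0, c (n - 1)} C ord)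
    (h0 : G.degree (c 0) = 2) {y v : V} (hbad : BadPath G ord τ (c (n - 1)) y (c 0) v)
    (hcov : ∃ e ∈ τ, c 2 ∈ e) :
    {c 1, c 2} ∉ τ ∧ ∃ e ∈ τ, c 2 ∈ e ∧ (∀ e' ∈ τ, c 2 ∈ e' → e' = e) ∧
      IsBridge (insert {c 1, c 2} (insert {c (n - 1), c 0} τ)) e := by
  have hinj : ∀ {i j : ℕ}, i < n → j < n → (c i = c j ↔ i = j) := fun hi hj =>
    h.eq_iff_of_lt hi hj
  have h01 := h.pair_mem_of_badPath h0 hbad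
  have hmem : ∀ {i j : ℕ} {z : V}, z ∈ ({c i, c j} : Finset V) ↔ z = c i ∨ z = c j := by simp
  have htop : ∀ {i j : ℕ}, 0 < i → i < n - 1 → ({c i, c j} : Finset V) ≠ {c 0, c (n - 1)} := by
    intro i j hi hi' heq
    have : c i ∈ ({c 0, c (n - 1)} : Finset V) := by simp [← heq]
    rw [hmem, hinj (by omega) (by omega), hinj (by omega) (by omega)] at this
    omega
  have h12 : {c 1, c 2} ∉ τ := by
    intro h12
    have hle := hbad.left.le_bridge {c 0, c 1} (isBridge_iff_forall_exists_ne.2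
      ⟨by simp [h01], fun z hz => ?_⟩)
    · rw [Finset.pair_comm (c (n - 1))] at hle
      refine hle.not_gt (hord.lt_top _ ?_)
      rw [Finset.pair_comm]
      exact htop (by omega) (by omega)
    · rcases hmem.1 hz with rfl | rfl
      · refine ⟨{c (n - 1), c 0}, by simp, fun heq => ?_, by simp⟩
        have : c (n - 1) ∈ ({c 0, c 1} : Finset V) := by simp [← heq]
        rw [hmem, hinj (by omega) (by omega), hinj (by omega) (by omega)] at this
        omega
      · refine ⟨{c 1, c 2}, by simp [h12], fun heq => ?_, by simp⟩
        have : c 2 ∈ ({c 0, c 1} : Finset V) := by simp [← heq]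
        rw [hmem, hinj (by omega) (by omega), hinj (by omega) (by omega)] at this
        omega
  refine ⟨h12, ?_⟩
  obtain ⟨e, he, hlt, hb, hnb⟩ := hbad.left.gap {c 1, c 2} (pair_mem_edgeSets.2 (h.adj 1)) h12
    (fun z hz => by
      rcases hmem.1 hz with rfl | rfl
      exacts [⟨_, h01, by simp⟩, hcov])
    (by rw [Finset.pair_comm (c (n - 1))]; exact hord.lt_top _ (htop (by omega) (by omega)))
  have hb' := (isBridge_iff_forall_exists_ne.1 hb).2
  rw [isBridge_iff_forall_exists_ne] at hnb
  push Not at hnb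
  obtain ⟨z, hz, hz'⟩ := hnb (Finset.mem_insert_of_mem he)
  obtain ⟨e', he', hne, hze'⟩ := hb' z hz
  rcases Finset.mem_insert.1 he' with rfl | he'
  · rcases hmem.1 hze' with rfl | rfl
    · obtain rfl : {c 0, c 1} = e := by
        by_contra hne'
        exact hz' _ (Finset.mem_insert_of_mem h01) hne' (by simp)
      refine absurd hlt (hord.lt_of_sup_lt _ _ (htop (by omega) (by omega)) ?_).not_gt
      simp only [Finset.sup_insert, Finset.sup_singleton]
      rw [hd.apply_cycle 0 (by omega), hd.apply_cycle 1 (by omega), hd.apply_cycle 2 (by omega)]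
      decide
    · refine ⟨e, he, hz, fun e' he' hze' => ?_, hb⟩
      by_contra hne'
      exact hz' _ (Finset.mem_insert_of_mem he') hne' hze'
  · exact absurd hze' (hz' _ he' hne)

lemma not_badPath_three (h : IsUniqueCycle G 3 c) (h0 : G.degree (c 0) = 2) :
    ¬ BadPath G ord τ (c 2) (c 1) (c 0) (c 0) := by
  intro hbad
  have := h.pair_mem_of_badPath h0 hbad
  rw [Finset.pair_comm] at this
  exact hbad.right.notMem this

lemma not_badPath_five (h : IsUniqueCycle G 5 c) (hd : IsDepth G 5 c d)
    (hord : IsDepthOrder d {c 0, c 4} {{c 4, c 3}, {c 3, c 2}} ord)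
    (h0 : G.degree (c 0) = 2) : ¬ BadPath G ord τ (c 4) (c 3) (c 0) (c 2) := by
  intro hbad
  have hinj : ∀ {i j : ℕ}, i < 5 → j < 5 → (c i = c j ↔ i = j) := fun hi hj =>
    h.eq_iff_of_lt hi hj
  have hd1 := hd.apply_cycle 1 (by omega)
  have hd2 := hd.apply_cycle 2 (by omega)
  have hd3 := hd.apply_cycle 3 (by omega)
  have hd4 := hd.apply_cycle 4 (by omega)
  obtain ⟨h12, e, he, h2e, -, hb⟩ := h.exists_isBridge_of_badPath le_rfl hd hord h0 hbad
    (hbad.right.cover (c 2) (by simp))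
  obtain ⟨t, ht, rfl⟩ := exists_eq_pair_of_mem (hbad.sub he) h2e
  have ht0 : t ≠ c 0 := by
    rintro rfl
    rcases (h.degree_eq_two_iff 0).1 h0 _ ht.symm with heq | heq
    · rw [hinj (by omega) (by omega)] at heq
      omega
    · rw [hinj (by omega) (by omega)] at heq
      omega
  have ht1 : t ≠ c 1 := by
    rintro rfl
    rw [Finset.pair_comm] at he
    exact h12 he
  have ht3 : t ≠ c 3 := by
    rintro rfl
    rw [Finset.pair_comm] at he
    exact hbad.right.notMem he
  have ht4 : t ≠ c 4 := by
    rintro rfl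
    have := hbad.only_left _ he (by simp)
    have : c 2 ∈ ({c 4, c 3} : Finset V) := by simp [← this]
    simp [hinj] at this
  have hdt : d t = 3 := by
    rcases hd.step ht (by simp [hinj]) with h1 | h1
    · exact absurd (hd.eq_of_adj ht (h.adj 1).symm h1 (by omega)) ht1
    · omega
  have hle := hbad.right.le_bridge {c 2, t} (isBridge_iff_forall_exists_ne.2
    ⟨Finset.mem_insert_of_mem he, fun z hz => ?_⟩)
  · refine hle.not_gt (hord.lt_of_notMem _ _ ?_ ?_ (Or.inr rfl) ?_)
    · intro heq
      have : t ∈ ({c 0, c 4} : Finset V) := by simp [← heq]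
      simp [ht0, ht4] at this
    · simp only [Finset.sup_insert, Finset.sup_singleton]
      rw [hd2, hd3, hdt]
      decide
    · rintro (heq | heq)
      · have : t ∈ ({c 4, c 3} : Finset V) := by simp [← heq]
        simp [ht3, ht4] at this
      · have : t ∈ ({c 3, c 2} : Finset V) := by simp [← Set.mem_singleton_iff.1 heq]
        simp [ht3, ht.ne.symm] at this
  · rcases Finset.mem_insert.1 hz with rfl | hz
    · refine ⟨{c 3, c 2}, by simp, fun heq => hbad.right.notMem (heq ▸ he), by simp⟩
    · obtain rfl := Finset.mem_singleton.1 hz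
      obtain ⟨e', he', hne, hze'⟩ := (isBridge_iff_forall_exists_ne.1 hb).2 z (by simp)
      rcases Finset.mem_insert.1 he' with rfl | he'
      · simp [ht1, ht.ne.symm] at hze'
      rcases Finset.mem_insert.1 he' with rfl | he'
      · simp [ht0, ht4] at hze'
      · exact ⟨e', Finset.mem_insert_of_mem he', hne, hze'⟩

lemma not_badPath_six (h : IsUniqueCycle G 6 c) (hd : IsDepth G 6 c d) {C : Set (Finset V)}
    (hord : IsDepthOrder d {c 0, c 5} C ord) (h0 : G.degree (c 0) = 2)
    (h3 : G.degree (c 3) = 2) : ¬ BadPath G ord τ (c 5) (c 4) (c 0) (c 3) := by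
  intro hbad
  have hinj : ∀ {i j : ℕ}, i < 6 → j < 6 → (c i = c j ↔ i = j) := fun hi hj =>
    h.eq_iff_of_lt hi hj
  have huniq : ∀ e ∈ τ, c 3 ∈ e → e = {c 3, c 2} := by
    intro e he h3e
    obtain ⟨w, hw, rfl⟩ := exists_eq_pair_of_mem (hbad.sub he) h3e
    rcases (h.degree_eq_two_iff 3).1 h3 w hw with rfl | rfl
    · rw [Finset.pair_comm] at he
      exact absurd he hbad.right.notMem
    · rw [(h.eq_iff (3 + (6 - 1)) 2).2 (by decide)]
  have h32 : {c 3, c 2} ∈ τ := by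
    obtain ⟨e, he, h3e⟩ := hbad.right.cover (c 3) (by simp)
    exact huniq e he h3e ▸ he
  obtain ⟨-, e, he, h2e, hunique, hb⟩ := h.exists_isBridge_of_badPath (by omega) hd hord h0 hbad
    ⟨_, h32, by simp⟩
  obtain rfl := hunique _ h32 (by simp)
  obtain ⟨e', he', hne, h3e'⟩ := (isBridge_iff_forall_exists_ne.1 hb).2 (c 3) (by simp)
  rcases Finset.mem_insert.1 he' with rfl | he'
  · simp [hinj] at h3e'
  rcases Finset.mem_insert.1 he' with rfl | he'
  · simp [hinj] at h3e'
  · exact hne (huniq e' he' h3e')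

lemma bridgeFriendly (h : IsUniqueCycle G n c) (hconn : G.Connected)
    (hc : HasOppositeDegreeTwo G n c) : BridgeFriendly (edgeSets G) := by
  obtain ⟨k, hk⟩ : ∃ k, G.degree (c k) = 2 ∧
      (n = 3 ∨ n = 5 ∨ n = 6 ∧ G.degree (c (k + 3)) = 2) := by
    rcases hc with ⟨hn, i, hi⟩ | ⟨hn, i, hi, hi'⟩
    · exact ⟨i, hi, hn.imp_right Or.inl⟩
    · exact ⟨i, hi, Or.inr (Or.inr ⟨hn, hi'⟩)⟩
  rw [← zero_add k, show 0 + k + 3 = 3 + k by omega] at hk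
  obtain ⟨h0, hn⟩ := hk
  have hs := h.shift k
  by_contra hG
  obtain ⟨d, hd⟩ := hs.exists_isDepth hconn
  obtain ⟨ord, hord⟩ := exists_isDepthOrder d {c (0 + k), c (n - 1 + k)}
    {{c (n - 1 + k), c (n - 2 + k)}, {c (n - 2 + k), c (n - 3 + k)}}
  obtain ⟨τ, hbad⟩ := hs.exists_badPath_cycle hd hord hG
  rcases hn with rfl | rfl | ⟨rfl, h3⟩
  · exact hs.not_badPath_three h0 hbad
  · exact hs.not_badPath_five hd hord h0 hbad
  · exact hs.not_badPath_six hd hord h0 h3 hbad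

end IsUniqueCycle

end Sufficiency

/-- Characterization of the connected unicyclic graphs `G` whose edge ideal `I(G)` is
bridge-friendly: `I(G)` is bridge-friendly iff either the unique cycle of `G` is a
`C₃` or a `C₅` containing a vertex of degree `2`, or it is a `C₆` containing two
opposite vertices (at distance `3` along the cycle) of degree `2`. -/
theorem bridgeFriendly_unicyclic_iff {V : Type*} [Fintype V] [DecidableEq V]
    (G : SimpleGraph V) [DecidableRel G.Adj]
    (hconn : G.Connected) (huni : ExactlyOneCycle G) :
    BridgeFriendly (edgeSets G) ↔
      ((∃ (u : V) (w : G.Walk u u), w.IsCycle ∧ (w.length = 3 ∨ w.length = 5) ∧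
          ∃ v ∈ w.support, G.degree v = 2) ∨
        (∃ (u : V) (w : G.Walk u u), w.IsCycle ∧ w.length = 6 ∧
          ∃ i < 3, G.degree (w.getVert i) = 2 ∧ G.degree (w.getVert (i + 3)) = 2)) := by
  constructor
  · intro hG
    obtain ⟨u, w, hw⟩ := huni.1
    have h := huni.isUniqueCycle hw
    rcases h.hasOppositeDegreeTwo hG with ⟨hn, i, hi⟩ | ⟨hn, i, hi, hi'⟩
    · exact Or.inl ⟨u, w, hw, hn, _, w.getVert_mem_support _, hi⟩
    · refine Or.inr ⟨u, w, hw, hn, ?_⟩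
      rw [hn] at hi hi'
      have hlt : i % 6 < 6 := Nat.mod_lt _ (by omega)
      rcases Nat.lt_or_ge (i % 6) 3 with h3 | h3
      · exact ⟨i % 6, h3, hi, by rwa [show i % 6 + 3 = (i + 3) % 6 by omega]⟩
      · refine ⟨i % 6 - 3, by omega, ?_, ?_⟩
        · rwa [show i % 6 - 3 = (i + 3) % 6 by omega]
        · rwa [show i % 6 - 3 + 3 = i % 6 by omega]
  · rintro (⟨u, w, hw, hn, v, hv, hdeg⟩ | ⟨u, w, hw, hn, i, hi, hdeg, hdeg'⟩)
    · refine (huni.isUniqueCycle hw).bridgeFriendly hconn (Or.inl ⟨hn, ?_⟩)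
      obtain ⟨i, rfl, hi⟩ := SimpleGraph.Walk.mem_support_iff_exists_getVert.1 hv
      rcases hi.lt_or_eq with hi | rfl
      · exact ⟨i, by beta_reduce; rwa [Nat.mod_eq_of_lt hi]⟩
      · rw [SimpleGraph.Walk.getVert_length, ← w.getVert_zero] at hdeg
        exact ⟨0, by beta_reduce; rwa [Nat.zero_mod]⟩
    · refine (huni.isUniqueCycle hw).bridgeFriendly hconn (Or.inr ⟨hn, i, ?_, ?_⟩)
      · beta_reduce; rwa [Nat.mod_eq_of_lt (by omega)]
      · beta_reduce; rwa [Nat.mod_eq_of_lt (by omega)]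
end

section
/- Let G be the net graph: the simple graph on vertices {1,2,3,4,5,6} whose edges are the triangle {1,2},{2,3},{1,3} together with the pendant edges {1,4},{2,5},{3,6}. Then the edge ideal I(G) is not bridge-friendly. -/
instance {α : Type*} [DecidableEq α] (σ : Finset (Finset α)) (m : Finset α) :
    Decidable (IsBridge σ m) :=
  inferInstanceAs (Decidable (_ ∧ _))

/-- If `b` is the only bridge of `σ`, every gap of `σ` is `c`, and adding `c` creates a new
bridge `a` dominated by `c`, then `σ` has no true gap and is potentially-type-2. -/
theorem PotType2.of_unique_bridge {α : Type*} [DecidableEq α] {M : Set (Finset α)}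
    {ord : Finset α → ℕ} {σ : Finset (Finset α)} {a b c : Finset α}
    (hb : ∀ m, IsBridge σ m ↔ m = b) (hc : ∀ g, IsGap M σ g → g = c)
    (ha : IsBridge (insert c σ) a) (hab : a ≠ b) (hac : ord a < ord c) :
    PotType2 M ord σ := by
  refine ⟨b, (hb b).2 rfl, fun g hg _ => hab ?_⟩
  obtain rfl := hc g hg.1
  exact (hb a).1 (hg.2 a ha hac)

theorem IsSBridge.of_unique_bridge {α : Type*} [DecidableEq α] {σ : Finset (Finset α)}
    {b : Finset α} (ord : Finset α → ℕ) (hb : ∀ m, IsBridge σ m ↔ m = b) :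
    IsSBridge ord σ b :=
  ⟨(hb b).2 rfl, fun b' hb' => ((hb b').1 hb').symm ▸ le_rfl⟩

/-- Two different potentially-type-2 sets that agree after removing their smallest bridges
cannot both be type-2. -/
theorem not_forall_type2 {α : Type*} [DecidableEq α] {M : Set (Finset α)}
    {ord : Finset α → ℕ} {σ σ' : Finset (Finset α)} {b b' : Finset α}
    (hσ : ↑σ ⊆ M) (hσ' : ↑σ' ⊆ M) (hne : σ' ≠ σ) (hp : PotType2 M ord σ)
    (hp' : PotType2 M ord σ') (hb : IsSBridge ord σ b) (hb' : IsSBridge ord σ' b')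
    (he : σ'.erase b' = σ.erase b) :
    ¬ ∀ τ : Finset (Finset α), ↑τ ⊆ M → PotType2 M ord τ → Type2 M ord τ := fun h =>
  lt_asymm ((h σ hσ hp).2 σ' hσ' hne hp' b b' hb hb' he)
    ((h σ' hσ' hp').2 σ hσ hne.symm hp b' b hb' hb he.symm)

/-- For a triangle with edges `a`, `b`, `c` and a pendant edge `r` at the vertex `b ∩ c`, an
order in which `a` is the smallest edge of the triangle is not bridge-friendly: the sets
`{a, b, r}` and `{a, c, r}` are in conflict. -/
theorem not_forall_type2_of_triangle {α : Type*} [DecidableEq α] {M : Set (Finset α)}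
    {ord : Finset α → ℕ} {a b c r : Finset α}
    (hb : ∀ m, IsBridge {a, b, r} m ↔ m = b) (hc : ∀ m, IsBridge {a, c, r} m ↔ m = c)
    (hgc : ∀ g, IsGap M {a, b, r} g → g = c) (hgb : ∀ g, IsGap M {a, c, r} g → g = b)
    (ha : IsBridge {a, b, c, r} a) (hM : ({a, b, c, r} : Set (Finset α)) ⊆ M)
    (hn : a ≠ b ∧ a ≠ c ∧ b ≠ c ∧ b ≠ r ∧ c ≠ r) (hab : ord a < ord b) (hac : ord a < ord c) :
    ¬ ∀ τ : Finset (Finset α), ↑τ ⊆ M → PotType2 M ord τ → Type2 M ord τ := by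
  obtain ⟨nab, nac, nbc, nbr, ncr⟩ := hn
  have hbc : insert c ({a, b, r} : Finset (Finset α)) = {a, b, c, r} := by ext; simp; tauto
  have hcb : insert b ({a, c, r} : Finset (Finset α)) = {a, b, c, r} := by ext; simp; tauto
  refine not_forall_type2 (σ := {a, b, r}) (σ' := {a, c, r}) (b := b) (b' := c)
    (subset_trans ?_ hM) (subset_trans ?_ hM) ?_
    (.of_unique_bridge hb hgc (hbc ▸ ha) nab hac) (.of_unique_bridge hc hgb (hcb ▸ ha) nac hab)
    (.of_unique_bridge ord hb) (.of_unique_bridge ord hc) ?_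
  · intro x; simp; tauto
  · intro x; simp; tauto
  · intro h
    have : b ∈ ({a, c, r} : Finset (Finset α)) := h ▸ by simp
    simp [nab.symm, nbc, nbr] at this
  · ext x; simp; grind

/-- The edge ideal of the net graph (a triangle `0-1-2` with pendant vertices `3, 4, 5`
attached to `0, 1, 2` respectively) is not bridge-friendly.  (Vertices `1,…,6` of the
statement are relabelled `0,…,5`.) -/
theorem net_not_bridgeFriendly :
    ¬ BridgeFriendly ({{0, 1}, {1, 2}, {0, 2}, {0, 3}, {1, 4}, {2, 5}} :
      Set (Finset (Fin 6))) := by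
  rintro ⟨ord, hinj, h⟩
  have key : ∀ a b c r : Finset (Fin 6),
      (a, b, c, r) ∈ ({({0, 1}, {1, 2}, {0, 2}, {2, 5}), ({1, 2}, {0, 1}, {0, 2}, {0, 3}),
        ({0, 2}, {0, 1}, {1, 2}, {1, 4})} : Finset (_ × _ × _ × _)) →
      ¬ (ord a < ord b ∧ ord a < ord c) := by
    rintro a b c r hmem ⟨hab, hac⟩
    simp only [Finset.mem_insert, Finset.mem_singleton, Prod.mk.injEq] at hmem
    refine not_forall_type2_of_triangle (r := r) ?_ ?_ ?_ ?_ ?_ ?_ ?_ hab hac h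
    all_goals
      clear hab hac
      obtain ⟨rfl, rfl, rfl, rfl⟩ | ⟨rfl, rfl, rfl, rfl⟩ | ⟨rfl, rfl, rfl, rfl⟩ := hmem
    all_goals first
      | decide
      | (rintro g ⟨hM, hg⟩
         obtain rfl | rfl | rfl | rfl | rfl | rfl := hM <;> revert hg <;> decide)
      | (intro x; simp; tauto)
  have hab : ord {0, 1} ≠ ord {1, 2} := hinj.ne (by simp) (by simp) (by decide)
  have hac : ord {0, 1} ≠ ord {0, 2} := hinj.ne (by simp) (by simp) (by decide)
  have hbc : ord {1, 2} ≠ ord {0, 2} := hinj.ne (by simp) (by simp) (by decide)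
  have h₁ := key {0, 1} {1, 2} {0, 2} {2, 5} (by simp)
  have h₂ := key {1, 2} {0, 1} {0, 2} {0, 3} (by simp)
  have h₃ := key {0, 2} {0, 1} {1, 2} {1, 4} (by simp)
  omega
end

section
/- Let G be the 135-trimethylcyclohexane graph: the simple graph on vertices {1,...,9} whose edges are the 6-cycle {1,2},{2,3},{3,4},{4,5},{5,6},{6,1} together with pendant edges {1,7},{3,8},{5,9} attached at three alternating cycle vertices. Then the edge ideal I(G) is not bridge-friendly. -/
/-- If `m ≺ a` and `m ≺ c`, where `a` is the only bridge of `τ ∪ {a}` and `c` its only possible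
gap, and symmetrically for `τ ∪ {c}`, while adding both makes `m` a bridge, then `τ ∪ {a}` and
`τ ∪ {c}` are potentially-type-2 sets that prevent each other from both being type-2. -/
theorem not_forall_type2_of_swap {α : Type*} [DecidableEq α] {E τ : Finset (Finset α)}
    {ord : Finset α → ℕ} {m a c : Finset α} (hma : ord m < ord a) (hmc : ord m < ord c)
    (hτ : insert a (insert c τ) ⊆ E) (haτ : a ∉ insert c τ) (hcτ : c ∉ insert a τ)
    (hm : IsBridge (insert a (insert c τ)) m)
    (hba : ∀ x ∈ insert a τ, IsBridge (insert a τ) x ↔ x = a)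
    (hbc : ∀ x ∈ insert c τ, IsBridge (insert c τ) x ↔ x = c)
    (hga : ∀ x ∈ E, x ∉ insert a τ → lcmU (insert x (insert a τ)) = lcmU (insert a τ) → x = c)
    (hgc : ∀ x ∈ E, x ∉ insert c τ → lcmU (insert x (insert c τ)) = lcmU (insert c τ) → x = a) :
    ¬ ∀ σ : Finset (Finset α), (σ : Set (Finset α)) ⊆ E → PotType2 (E : Set (Finset α)) ord σ →
      Type2 (E : Set (Finset α)) ord σ := by
  intro h
  have sbridge_of_unique {a : Finset α}
      (hb : ∀ x ∈ insert a τ, IsBridge (insert a τ) x ↔ x = a) :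
      IsSBridge ord (insert a τ) a :=
    ⟨(hb a (by simp)).2 rfl, fun b hb' => by rw [(hb b hb'.1).1 hb']⟩
  have potType2_of_unique {a c : Finset α} (hmc : ord m < ord c) (hma : ord m < ord a)
      (hm : IsBridge (insert c (insert a τ)) m)
      (hb : ∀ x ∈ insert a τ, IsBridge (insert a τ) x ↔ x = a)
      (hg : ∀ x ∈ E, x ∉ insert a τ →
        lcmU (insert x (insert a τ)) = lcmU (insert a τ) → x = c) :
      PotType2 (E : Set (Finset α)) ord (insert a τ) := by
    refine ⟨a, (hb a (by simp)).2 rfl, fun g ⟨⟨hgE, hgσ, hgl⟩, htrue⟩ _ => ?_⟩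
    obtain rfl := hg g hgE hgσ hgl
    have hbm := htrue m hm hmc
    obtain rfl := (hb m hbm.1).1 hbm
    exact lt_irrefl _ hma
  have hpa := potType2_of_unique hmc hma (by rwa [Finset.insert_comm]) hba hga
  have hpc := potType2_of_unique hma hmc hm hbc hgc
  have hEa : ((insert a τ : Finset (Finset α)) : Set (Finset α)) ⊆ E := by
    exact_mod_cast (Finset.insert_subset_insert a (Finset.subset_insert c τ)).trans hτ
  have hEc : ((insert c τ : Finset (Finset α)) : Set (Finset α)) ⊆ E := by
    exact_mod_cast (Finset.subset_insert a _).trans hτ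
  have hne : insert c τ ≠ insert a τ := fun h => haτ (h ▸ Finset.mem_insert_self a τ)
  have herase : (insert c τ).erase c = (insert a τ).erase a := by
    rw [Finset.erase_insert (by simp_all), Finset.erase_insert (by simp_all)]
  have hac := (h _ hEa hpa).2 _ hEc hne hpc a c (sbridge_of_unique hba) (sbridge_of_unique hbc)
    herase
  have hca := (h _ hEc hpc).2 _ hEa hne.symm hpa c a (sbridge_of_unique hbc)
    (sbridge_of_unique hba) herase.symm
  exact lt_asymm hac hca

set_option maxRecDepth 8000 in
/-- The edge ideal of the 135-trimethylcyclohexane graph (a 6-cycle `0-1-2-3-4-5` with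
pendant vertices `6, 7, 8` attached to the three alternating cycle vertices `0, 2, 4`)
is not bridge-friendly.  (Vertices `1,…,9` of the statement are relabelled `0,…,8`.) -/
theorem trimethyl135_not_bridgeFriendly :
    ¬ BridgeFriendly ({{0, 1}, {1, 2}, {2, 3}, {3, 4}, {4, 5}, {5, 0},
        {0, 6}, {2, 7}, {4, 8}} : Set (Finset (Fin 9))) := by
  rintro ⟨ord, hinj, h⟩
  let E : Finset (Finset (Fin 9)) := {{0, 1}, {1, 2}, {2, 3}, {3, 4}, {4, 5}, {5, 0},
    {0, 6}, {2, 7}, {4, 8}}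
  let cycle : Finset (Finset (Fin 9)) := {{0, 1}, {1, 2}, {2, 3}, {3, 4}, {4, 5}, {5, 0}}
  have hE : ({{0, 1}, {1, 2}, {2, 3}, {3, 4}, {4, 5}, {5, 0}, {0, 6}, {2, 7}, {4, 8}} :
      Set (Finset (Fin 9))) = E := by
    simp [E]
  rw [hE] at hinj h
  obtain ⟨m, hm, hmin⟩ := cycle.exists_min_image ord ⟨{0, 1}, by decide⟩
  have hcycle : cycle ⊆ E := by decide
  have hlt : ∀ x ∈ cycle, x ≠ m → ord m < ord x := fun x hx hxm =>
    (hmin x hx).lt_of_ne fun he => hxm (hinj (hcycle hx) (hcycle hm) he.symm)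
  -- The smallest cycle edge `m` precedes both of its neighbours `a` and `c` on the cycle.
  have contra (τ : Finset (Finset (Fin 9))) (a c : Finset (Fin 9)) (ha : a ∈ cycle ∧ a ≠ m)
      (hc : c ∈ cycle ∧ c ≠ m) :=
    not_forall_type2_of_swap (E := E) (τ := τ) (hlt a ha.1 ha.2) (hlt c hc.1 hc.2)
  simp only [cycle, Finset.mem_insert, Finset.mem_singleton] at hm
  rcases hm with rfl | rfl | rfl | rfl | rfl | rfl
  · exact contra {{0, 1}, {4, 5}, {2, 7}} {1, 2} {5, 0} (by decide) (by decide) (by decide)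
      (by decide) (by decide) (by decide) (by decide) (by decide) (by decide) (by decide) h
  · exact contra {{1, 2}, {3, 4}, {0, 6}} {0, 1} {2, 3} (by decide) (by decide) (by decide)
      (by decide) (by decide) (by decide) (by decide) (by decide) (by decide) (by decide) h
  · exact contra {{2, 3}, {0, 1}, {4, 8}} {1, 2} {3, 4} (by decide) (by decide) (by decide)
      (by decide) (by decide) (by decide) (by decide) (by decide) (by decide) (by decide) h
  · exact contra {{3, 4}, {5, 0}, {2, 7}} {2, 3} {4, 5} (by decide) (by decide) (by decide)
      (by decide) (by decide) (by decide) (by decide) (by decide) (by decide) (by decide) h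
  · exact contra {{4, 5}, {2, 3}, {0, 6}} {3, 4} {5, 0} (by decide) (by decide) (by decide)
      (by decide) (by decide) (by decide) (by decide) (by decide) (by decide) (by decide) h
  · exact contra {{5, 0}, {1, 2}, {4, 8}} {0, 1} {4, 5} (by decide) (by decide) (by decide)
      (by decide) (by decide) (by decide) (by decide) (by decide) (by decide) (by decide) h
end

section
/- Let H = (V, E) be a rooted hypertree. Then the edge ideal I(H), i.e., the squarefree monomial ideal whose set of minimal generators is E, is bridge-friendly. -/
/-- `T` is a host graph of the hypergraph with edge set `E`: for each edge `e ∈ E`, the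
induced subgraph of `T` on the vertices of `e` is connected. -/
def IsHostGraph {V : Type*} [DecidableEq V] (T : SimpleGraph V) (E : Set (Finset V)) : Prop :=
  ∀ e ∈ E, (SimpleGraph.induce (↑e : Set V) T).Connected

/-- The tree `T` together with the vertex `x` is a host tree of the hypergraph with edge
set `E` rooted at `x`: `T` is a tree host graph and the distances in `T` from `x` to the
vertices of any single edge are pairwise distinct. -/
def IsRootedHostTree {V : Type*} [DecidableEq V] (T : SimpleGraph V) (x : V)
    (E : Set (Finset V)) : Prop :=
  T.IsTree ∧ IsHostGraph T E ∧
    ∀ e ∈ E, ∀ v ∈ e, ∀ w ∈ e, v ≠ w → T.dist x v ≠ T.dist x w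

theorem isBridge_iff {α : Type*} [DecidableEq α] {σ : Finset (Finset α)} {m : Finset α} :
    IsBridge σ m ↔ m ∈ σ ∧ ∀ v ∈ m, ∃ n ∈ σ, n ≠ m ∧ v ∈ n := by
  refine and_congr_right fun hm => ⟨fun h v hv => ?_, fun h => ?_⟩
  · have hvσ : v ∈ lcmU σ := Finset.mem_sup.mpr ⟨m, hm, hv⟩
    rw [← h] at hvσ
    obtain ⟨n, hn, hvn⟩ := Finset.mem_sup.mp hvσ
    exact ⟨n, Finset.mem_of_mem_erase hn, Finset.ne_of_mem_erase hn, hvn⟩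
  · refine le_antisymm (Finset.sup_mono (Finset.erase_subset m σ)) fun v hv => ?_
    obtain ⟨n, hn, hvn⟩ := Finset.mem_sup.mp hv
    by_cases hnm : n = m
    · obtain ⟨k, hk, hkm, hvk⟩ := h v (hnm ▸ hvn)
      exact Finset.mem_sup.mpr ⟨k, Finset.mem_erase.mpr ⟨hkm, hk⟩, hvk⟩
    · exact Finset.mem_sup.mpr ⟨n, Finset.mem_erase.mpr ⟨hnm, hn⟩, hvn⟩

theorem isGap_iff {α : Type*} [DecidableEq α] {M : Set (Finset α)} {σ : Finset (Finset α)}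
    {m : Finset α} : IsGap M σ m ↔ m ∈ M ∧ m ∉ σ ∧ ∀ v ∈ m, ∃ n ∈ σ, v ∈ n := by
  have h : lcmU (insert m σ) = lcmU σ ↔ m ⊆ lcmU σ := by
    simp only [lcmU, Finset.sup_insert, id]
    exact sup_eq_right
  rw [IsGap, h]
  simp only [Finset.subset_iff, lcmU, Finset.mem_sup, id]

/-- If a potentially-type-2 set were not type-2, there would be generators `m ≺ c ≺ b` with
`b ∩ m` and `c ∩ m` incomparable; an order excluding this witnesses bridge-friendliness. -/
theorem bridgeFriendly_of_forall_lt_or_lt {α : Type*} [DecidableEq α] {M : Set (Finset α)}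
    {ord : Finset α → ℕ} (hinj : Set.InjOn ord M)
    (hord : ∀ m ∈ M, ∀ b ∈ M, ∀ c ∈ M, ∀ v ∈ m, ∀ w ∈ m,
      v ∈ c → v ∉ b → w ∈ b → w ∉ c → ord b < ord m ∨ ord c < ord m) :
    BridgeFriendly M := by
  refine ⟨ord, hinj, fun σ hσ hpot => ⟨hpot, fun σ' hσ' hne _ b b' hb hb' heq => ?_⟩⟩
  by_contra! hle
  have hbσ : b ∈ σ := hb.1.1
  have hbσ' : b' ∈ σ' := hb'.1.1
  have hbb' : b ≠ b' := by
    rintro rfl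
    exact hne (by rw [← Finset.insert_erase hbσ', heq, Finset.insert_erase hbσ])
  have hlt : ord b' < ord b :=
    lt_of_le_of_ne hle fun h => hbb' (hinj (hσ hbσ) (hσ' hbσ') h.symm)
  have mem_iff : ∀ n, (n ≠ b' ∧ n ∈ σ') ↔ (n ≠ b ∧ n ∈ σ) := fun n => by
    rw [← Finset.mem_erase, ← Finset.mem_erase, heq]
  have hb'σ : b' ∉ σ := fun h => ((mem_iff b').mpr ⟨hbb'.symm, h⟩).1 rfl
  obtain ⟨p, hp, hpg⟩ := hpot
  have hntg : ¬ IsTrueGap M ord σ b' := fun h => hpg b' h (hlt.trans_le (hb.2 p hp))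
  have hgap : IsGap M σ b' := by
    refine isGap_iff.mpr ⟨hσ' hbσ', hb'σ, fun v hv => ?_⟩
    obtain ⟨n, hn, hnb, hvn⟩ := (isBridge_iff.mp hb'.1).2 v hv
    exact ⟨n, ((mem_iff n).mp ⟨hnb, hn⟩).2, hvn⟩
  simp only [IsTrueGap, hgap, true_and, not_forall] at hntg
  obtain ⟨m, hm, hmlt, hmσ⟩ := hntg
  have hmb' : m ≠ b' := fun h => by simp [h] at hmlt
  have hmb : m ≠ b := fun h => hlt.not_gt (h ▸ hmlt)
  have hmem : m ∈ σ := (Finset.mem_insert.mp hm.1).resolve_left hmb'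
  have hmem' : m ∈ σ' := ((mem_iff m).mpr ⟨hmb, hmem⟩).2
  have hmσ' : ¬ IsBridge σ' m := fun h => (hb'.2 m h).not_gt hmlt
  rw [isBridge_iff] at hm hmσ hmσ'
  push Not at hmσ hmσ'
  obtain ⟨v, hvm, hv⟩ := hmσ hmem
  obtain ⟨w, hwm, hw⟩ := hmσ' hmem'
  have hvb' : v ∈ b' := by
    obtain ⟨n, hn, hnm, hvn⟩ := hm.2 v hvm
    rcases Finset.mem_insert.mp hn with rfl | hn
    · exact hvn
    · exact absurd hvn (hv n hn hnm)
  have hwb : w ∈ b := by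
    obtain ⟨n, hn, hnm, hwn⟩ := hm.2 w hwm
    by_contra hwb
    by_cases hnb' : n = b'
    · exact hw b' hbσ' hmb'.symm (hnb' ▸ hwn)
    · have hnb : n ≠ b := fun h => hwb (h ▸ hwn)
      have hn := (Finset.mem_insert.mp hn).resolve_left hnb'
      exact hw n ((mem_iff n).mpr ⟨hnb, hn⟩).2 hnm hwn
  rcases hord m (hσ hmem) b (hσ hbσ) b' (hσ' hbσ') v hvm w hwm hvb'
    (hv b hbσ hmb.symm) hwb (hw b' hbσ' hmb'.symm) with h | h <;> omega

/-- In a rooted tree, the neighbour of a vertex that is closer to the root is unique. -/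
theorem SimpleGraph.IsTree.eq_of_adj_of_dist_lt {V : Type*} {T : SimpleGraph V} (hT : T.IsTree)
    {x w a b : V} (ha : T.Adj a w) (hb : T.Adj b w) (hda : T.dist x a < T.dist x w)
    (hdb : T.dist x b < T.dist x w) : a = b := by
  have key : ∀ c, T.Adj c w → T.dist x c < T.dist x w →
      ∃ p : T.Walk x w, p.IsPath ∧ p.penultimate = c := fun c hc hdc => by
    obtain ⟨p, hp⟩ := hT.connected.exists_walk_length_eq_dist x c
    refine ⟨p.concat hc, ?_, by simp⟩
    apply SimpleGraph.Walk.isPath_of_length_eq_dist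
    rw [SimpleGraph.Walk.length_concat, hp]
    have := hT.dist_eq_dist_add_one_of_adj x hc
    omega
  obtain ⟨p, hp, rfl⟩ := key a ha hda
  obtain ⟨q, hq, rfl⟩ := key b hb hdb
  rw [(hT.existsUnique_path x w).unique hp hq]

/-- A connected set with pairwise distinct depths contains a neighbour, closer to the root, of
each of its vertices that is not its topmost one. -/
theorem exists_adj_dist_lt {V : Type*} {T : SimpleGraph V} {x : V} (hT : T.Connected)
    {e : Finset V}
    (hconn : (SimpleGraph.induce (↑e : Set V) T).Connected)
    (hdist : ∀ v ∈ e, ∀ w ∈ e, v ≠ w → T.dist x v ≠ T.dist x w)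
    {u w : V} (hu : u ∈ e) (hw : w ∈ e) (huw : T.dist x u < T.dist x w) :
    ∃ a ∈ e, T.Adj a w ∧ T.dist x a < T.dist x w := by
  obtain ⟨p⟩ := hconn.preconnected ⟨w, hw⟩ ⟨u, hu⟩
  obtain ⟨d, -, hd₁, hd₂⟩ :=
    p.exists_boundary_dart {y | T.dist x w ≤ T.dist x y} (le_refl (T.dist x w)) (not_le.mpr huw)
  have hadj : T.Adj d.fst d.snd := d.adj
  simp only [Set.mem_ofPred_eq, not_le] at hd₁ hd₂
  have hle : T.dist x d.fst ≤ T.dist x d.snd + 1 := by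
    have h := hT.dist_triangle (u := x) (v := d.snd) (w := d.fst)
    rwa [SimpleGraph.dist_eq_one_iff_adj.mpr hadj.symm] at h
  have hfst : (d.fst : V) = w := by
    by_contra hne
    exact hdist _ d.fst.2 w hw hne (by omega)
  exact ⟨d.snd, d.snd.2, hfst ▸ hadj.symm, hd₂⟩

theorem IsRootedHostTree.mem_of_dist_le {V : Type*} [DecidableEq V] {T : SimpleGraph V} {x : V}
    {E : Set (Finset V)} (h : IsRootedHostTree T x E) {e f : Finset V} (he : e ∈ E) (hf : f ∈ E)
    {u v : V} (hu : u ∈ f) (hv : v ∈ e) (huv : T.dist x u ≤ T.dist x v) {w : V}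
    (hwe : w ∈ e) (hwf : w ∈ f) (hvw : T.dist x v ≤ T.dist x w) : v ∈ f := by
  obtain ⟨hT, hhost, hdist⟩ := h
  induction hn : T.dist x w using Nat.strong_induction_on generalizing w with
  | _ n ih =>
    subst hn
    by_cases hvw' : v = w
    · exact hvw' ▸ hwf
    have hlt : T.dist x v < T.dist x w := lt_of_le_of_ne hvw (hdist e he v hv w hwe hvw')
    obtain ⟨a, hae, haw, had⟩ :=
      exists_adj_dist_lt hT.connected (hhost e he) (hdist e he) hv hwe hlt
    obtain ⟨b, hbf, hbw, hbd⟩ :=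
      exists_adj_dist_lt hT.connected (hhost f hf) (hdist f hf) hu hwf (huv.trans_lt hlt)
    obtain rfl := hT.eq_of_adj_of_dist_lt haw hbw had hbd
    have := hT.dist_eq_dist_add_one_of_adj x haw
    exact ih _ had hae hbf (by omega) rfl

/-- Any function to `ℕ` on a finite type is refined by an injective one. -/
theorem exists_injective_refinement {β : Type*} [Finite β] (f : β → ℕ) :
    ∃ g : β → ℕ, Function.Injective g ∧ ∀ a b, f a < f b → g a < g b := by
  obtain ⟨n, ⟨i⟩⟩ := Finite.exists_equiv_fin β
  have hlt : ∀ a b, f a < f b → f a * n + i a < f b * n + i b := fun a b h => by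
    have := (i a).2
    nlinarith [Nat.mul_le_mul_right n (Nat.succ_le_of_lt h)]
  refine ⟨fun a => f a * n + i a, fun a b hab => ?_, hlt⟩
  rcases lt_trichotomy (f a) (f b) with h | h | h
  · exact absurd hab (hlt a b h).ne
  · simp only [h] at hab
    exact i.injective (Fin.ext (by omega))
  · exact absurd hab (hlt b a h).ne'

/-- The edge ideal of a rooted hypertree is bridge-friendly.  Here a hypergraph on a
finite vertex set `V`, with edge set `E` a set of nonempty subsets of `V` forming an
antichain, is a rooted hypertree if it admits a host graph `T` that is a tree, rooted at
some `x : V` in the sense that each edge consists of vertices of pairwise different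
distances from `x` in `T`. -/
theorem rootedHypertree_bridgeFriendly {V : Type*} [Fintype V] [DecidableEq V]
    (E : Set (Finset V))
    (hne : ∀ e ∈ E, e.Nonempty)
    (hanti : ∀ e ∈ E, ∀ f ∈ E, e ⊆ f → e = f)
    (hrooted : ∃ (T : SimpleGraph V) (x : V), IsRootedHostTree T x E) :
    BridgeFriendly E := by
  obtain ⟨T, x, h⟩ := hrooted
  let N := Finset.univ.sup (T.dist x)
  have hN : ∀ v, T.dist x v ≤ N := fun v => Finset.le_sup (Finset.mem_univ v)
  let height : Finset V → ℕ := fun e => e.sup fun v => N - T.dist x v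
  obtain ⟨ord, hinj, hord⟩ := exists_injective_refinement height
  have key : ∀ m ∈ E, ∀ b ∈ E, ∀ v ∈ m, ∀ w ∈ m, v ∉ b → w ∈ b →
      T.dist x v ≤ T.dist x w → ord b < ord m := by
    intro m hm b hb v hvm w hwm hvb hwb hvw
    have hbelow : ∀ u ∈ b, T.dist x v < T.dist x u := fun u hu => by
      by_contra! huv
      exact hvb (h.mem_of_dist_le hm hb hu hvm huv hwm hwb hvw)
    have hvm' : N - T.dist x v ≤ height m :=
      Finset.le_sup (f := fun v => N - T.dist x v) hvm
    refine hord b m (lt_of_lt_of_le ((Finset.sup_lt_iff ?_).mpr fun u hu => ?_) hvm')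
    · have := hbelow w hwb
      have := hN w
      simp only [bot_eq_zero]
      omega
    · have := hbelow u hu
      have := hN u
      omega
  refine bridgeFriendly_of_forall_lt_or_lt hinj.injOn ?_
  intro m hm b hb c hc v hvm w hwm hvc hvb hwb hwc
  rcases le_total (T.dist x v) (T.dist x w) with hvw | hwv
  · exact Or.inl (key m hm b hb v hvm w hwm hvb hwb hvw)
  · exact Or.inr (key m hm c hc w hwm v hvm hwc hvc hwv)
end
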